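/- Let H be a complex Hilbert space, X ⊆ B(H) a linear subspace, e ∈ X with ‖e‖ = 1, D ⊆ X × X a domain, and m : D → X a non-degenerate partial product. Suppose the factorization seminorms ‖A‖^m := inf{ ‖X^{(1)}‖ ⋯ ‖X^{(N)}‖ : (X^{(1)}, …, X^{(N)}) permissible, A = X^{(1)} ⊙_m ⋯ ⊙_m X^{(N)} } are norms, i.e. ‖A‖^m > 0 whenever A ≠ 0. Then there exist a complex Hilbert space K and a linear map π : X → B(K) such that π(e) = I_K, π(m(a,b)) = π(a)π(b) for all (a,b) ∈ D, and π is completely isometric with respect to the factorization norms: ‖π^{(n,k)}(A)‖ = ‖A‖^m for every matrix A ∈ M_{n,k}(X). -/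

import Mathlib

noncomputable section

open scoped BigOperators

/-- A partial product on a complex vector space `V` with distinguished element `e`:
a domain `D ⊆ V × V` together with subspaces `R x` and `L x` (each containing `e`) witnessing
the domain conditions, and a (partially meaningful) product `m` which is unital and bilinear
where defined. -/
structure PartialProduct (V : Type*) [AddCommGroup V] [Module ℂ V] (e : V) where
  /-- The domain of the partial product. -/
  D : Set (V × V)
  /-- The partial product (as a total function; only its values on `D` are meaningful). -/
  m : V → V → V
  /-- For each `x`, a unital subspace `R x` with `ℂx × R x ⊆ D`. -/
  R : V → Submodule ℂ V
  /-- For each `y`, a unital subspace `L y` with `L y × ℂy ⊆ D`. -/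
  L : V → Submodule ℂ V
  unit_left : ∀ (c : ℂ) (x : V), (c • e, x) ∈ D
  unit_right : ∀ (c : ℂ) (x : V), (x, c • e) ∈ D
  e_mem_R : ∀ x : V, e ∈ R x
  e_mem_L : ∀ y : V, e ∈ L y
  mem_right : ∀ (x : V) (c : ℂ) (r : V), r ∈ R x → (c • x, r) ∈ D
  mem_left : ∀ (y : V) (c : ℂ) (l : V), l ∈ L y → (l, c • y) ∈ D
  m_unital_left : ∀ x : V, m e x = x
  m_unital_right : ∀ x : V, m x e = x
  m_add_left : ∀ (x y z : V) (c : ℂ), y ∈ L x → z ∈ L x →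
    m (y + c • z) x = m y x + c • m z x
  m_add_right : ∀ (x y z : V) (c : ℂ), y ∈ R x → z ∈ R x →
    m x (y + c • z) = m x y + c • m x z

/-- A pair of matrices over `V` is a valid pair for a partial product when all the relevant
entry pairs lie in the domain. -/
def PartialProduct.ValidPair {V : Type*} [AddCommGroup V] [Module ℂ V] {e : V}
    (P : PartialProduct V e) {n k l : ℕ}
    (A : Matrix (Fin n) (Fin k) V) (B : Matrix (Fin k) (Fin l) V) : Prop :=
  ∀ (i : Fin n) (r : Fin k) (j : Fin l), (A i r, B r j) ∈ P.D

/-- The matrix product `A ⊙_m B` of a valid pair. -/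
def PartialProduct.odot {V : Type*} [AddCommGroup V] [Module ℂ V] {e : V}
    (P : PartialProduct V e) {n k l : ℕ}
    (A : Matrix (Fin n) (Fin k) V) (B : Matrix (Fin k) (Fin l) V) :
    Matrix (Fin n) (Fin l) V :=
  Matrix.of fun i j => ∑ r, P.m (A i r) (B r j)

/-- The relation on the free (tensor) algebra `F(V)` identifying `a · b` with `m(a, b)` for
`(a, b) ∈ D`. -/
def PartialProduct.rel {V : Type*} [AddCommGroup V] [Module ℂ V] {e : V}
    (P : PartialProduct V e) :
    TensorAlgebra ℂ V → TensorAlgebra ℂ V → Prop := fun p q =>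
  ∃ a b : V, (a, b) ∈ P.D ∧
    p = TensorAlgebra.ι ℂ a * TensorAlgebra.ι ℂ b ∧ q = TensorAlgebra.ι ℂ (P.m a b)

/-- The algebra `F_m(V) = F(V)/J_m`. -/
abbrev PartialProduct.FreeAlg {V : Type*} [AddCommGroup V] [Module ℂ V] {e : V}
    (P : PartialProduct V e) : Type _ := RingQuot P.rel

/-- The canonical map `V → F_m(V)`, `v ↦ v + J_m`. -/
noncomputable def PartialProduct.emb {V : Type*} [AddCommGroup V] [Module ℂ V] {e : V}
    (P : PartialProduct V e) : V → P.FreeAlg :=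
  fun v => RingQuot.mkAlgHom ℂ P.rel (TensorAlgebra.ι ℂ v)

/-- A chain (tuple) of matrices over `V` with compatible dimensions, starting with `n` rows
and ending with `k` columns. -/
structure MatChain (V : Type*) (n k : ℕ) where
  /-- the number of matrices in the chain -/
  len : ℕ
  /-- the sequence of dimensions -/
  dims : Fin (len + 1) → ℕ
  dim_first : dims 0 = n
  dim_last : dims (Fin.last len) = k
  /-- the matrices: the `i`-th matrix has size `dims i × dims (i+1)` -/
  mats : ∀ i : Fin len, Matrix (Fin (dims i.castSucc)) (Fin (dims i.succ)) V

/-- The product of a chain of matrices over `V`, computed in a semiring `R` via a map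
`f : V → R`: the usual iterated matrix product `f(X⁽¹⁾) f(X⁽²⁾) ⋯ f(X⁽ᴺ⁾)`. -/
noncomputable def MatChain.prodIn {V : Type*} {n k : ℕ} (C : MatChain V n k)
    {R : Type*} [Semiring R] (f : V → R) : Matrix (Fin n) (Fin k) R :=
  Matrix.of fun i j =>
    ∑ p ∈ Finset.univ.filter
        (fun p : (∀ t : Fin (C.len + 1), Fin (C.dims t)) =>
          p 0 = Fin.cast C.dim_first.symm i ∧ p (Fin.last C.len) = Fin.cast C.dim_last.symm j),
      (List.ofFn fun t : Fin C.len => f (C.mats t (p t.castSucc) (p t.succ))).prod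

variable {H : Type} [NormedAddCommGroup H] [InnerProductSpace ℂ H] [CompleteSpace H]

/-- A matrix over `B(H)` viewed as a bounded operator between the `ℓ²`-direct sums `H^κ → H^ι`. -/
noncomputable def opMatCLM {ι κ : Type} [Fintype ι] [Fintype κ]
    (A : Matrix ι κ (H →L[ℂ] H)) :
    PiLp 2 (fun _ : κ => H) →L[ℂ] PiLp 2 (fun _ : ι => H) :=
  ((PiLp.continuousLinearEquiv 2 ℂ (fun _ : ι => H)).symm.toContinuousLinearMap) ∘L
    (ContinuousLinearMap.pi fun i => ∑ j, (A i j).comp (ContinuousLinearMap.proj j)) ∘L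
    ((PiLp.continuousLinearEquiv 2 ℂ (fun _ : κ => H)).toContinuousLinearMap)

/-- The operator norm of a matrix over `B(H)`, viewed as an operator `H^κ → H^ι`. -/
noncomputable def opMatNorm {ι κ : Type} [Fintype ι] [Fintype κ]
    (A : Matrix ι κ (H →L[ℂ] H)) : ℝ := ‖opMatCLM A‖

/-- The norm of a matrix over a subspace `X ⊆ B(H)`, computed in `B(H)`. -/
noncomputable def subMatNorm {X : Submodule ℂ (H →L[ℂ] H)} {ι κ : Type} [Fintype ι] [Fintype κ]
    (A : Matrix ι κ ↥X) : ℝ := opMatNorm (A.map (fun v => (v : H →L[ℂ] H)))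

/-- The cost of a chain of matrices over `X ⊆ B(H)`: the product of the norms of its
matrices. -/
noncomputable def chainCost {X : Submodule ℂ (H →L[ℂ] H)} {n k : ℕ}
    (C : MatChain ↥X n k) : ℝ :=
  ∏ t : Fin C.len, subMatNorm (C.mats t)

/-- The factorization seminorm `‖A‖^m`: the infimum of `‖X⁽¹⁾‖ ⋯ ‖X⁽ᴺ⁾‖` over all permissible
factorizations `A = X⁽¹⁾ ⊙_m ⋯ ⊙_m X⁽ᴺ⁾` (chains of matrices over `X` whose iterated product,
computed in `F_m(X)`, equals the image of `A`). -/
noncomputable def factNorm {X : Submodule ℂ (H →L[ℂ] H)} {e : ↥X}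
    (P : PartialProduct ↥X e) {n k : ℕ} (A : Matrix (Fin n) (Fin k) ↥X) : ℝ :=
  sInf { r : ℝ | ∃ C : MatChain ↥X n k, 1 ≤ C.len ∧
    C.prodIn P.emb = A.map P.emb ∧ r = chainCost C }

section Contractions

omit [CompleteSpace H]

theorem opMatNorm_le_iff {ι κ : Type} [Fintype ι] [Fintype κ]
    (A : Matrix ι κ (H →L[ℂ] H)) {c : ℝ} (hc : 0 ≤ c) :
    opMatNorm A ≤ c ↔
      ∀ v : κ → H, ∑ i, ‖∑ j, A i j (v j)‖ ^ 2 ≤ c ^ 2 * ∑ j, ‖v j‖ ^ 2 := by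
  have key : ∀ v : PiLp 2 (fun _ : κ => H), ‖opMatCLM A v‖ ≤ c * ‖v‖ ↔
      ∑ i, ‖∑ j, A i j (v j)‖ ^ 2 ≤ c ^ 2 * ∑ j, ‖v j‖ ^ 2 := by
    intro v
    rw [← sq_le_sq₀ (norm_nonneg _) (by positivity), mul_pow, PiLp.norm_sq_eq_of_L2,
      PiLp.norm_sq_eq_of_L2]
    simp [opMatCLM]
  unfold opMatNorm
  rw [ContinuousLinearMap.opNorm_le_iff hc]
  constructor
  · intro h v
    exact (key (WithLp.toLp 2 v)).1 (h _)
  · intro h v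
    exact (key v).2 (h _)

theorem opMatNorm_nonneg {ι κ : Type} [Fintype ι] [Fintype κ]
    (A : Matrix ι κ (H →L[ℂ] H)) : 0 ≤ opMatNorm A := by
  unfold opMatNorm
  positivity

theorem sum_norm_sq_le_opMatNorm {ι κ : Type} [Fintype ι] [Fintype κ]
    (A : Matrix ι κ (H →L[ℂ] H)) (v : κ → H) :
    ∑ i, ‖∑ j, A i j (v j)‖ ^ 2 ≤ opMatNorm A ^ 2 * ∑ j, ‖v j‖ ^ 2 :=
  (opMatNorm_le_iff A (opMatNorm_nonneg A)).1 le_rfl v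

theorem opMatNorm_mul_le {ι κ μ : Type} [Fintype ι] [Fintype κ] [Fintype μ]
    (A : Matrix ι κ (H →L[ℂ] H)) (B : Matrix κ μ (H →L[ℂ] H)) :
    opMatNorm (A * B) ≤ opMatNorm A * opMatNorm B := by
  have hA := opMatNorm_nonneg A
  have hB := opMatNorm_nonneg B
  rw [opMatNorm_le_iff _ (by positivity)]
  intro v
  have h1 := sum_norm_sq_le_opMatNorm A (fun j => ∑ l, B j l (v l))
  have h2 := sum_norm_sq_le_opMatNorm B v
  have h3 : ∀ i, ∑ l, (A * B) i l (v l) = ∑ j, A i j (∑ l, B j l (v l)) := by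
    intro i
    simp only [Matrix.mul_apply, sum_apply, map_sum,
      mul_apply_eq_comp]
    exact Finset.sum_comm
  simp only [h3]
  calc _ ≤ _ := h1
    _ ≤ opMatNorm A ^ 2 * (opMatNorm B ^ 2 * ∑ j, ‖v j‖ ^ 2) := by gcongr
    _ = _ := by ring

theorem opMatNorm_smul_le {ι κ : Type} [Fintype ι] [Fintype κ] (c : ℂ)
    (A : Matrix ι κ (H →L[ℂ] H)) : opMatNorm (c • A) ≤ ‖c‖ * opMatNorm A := by
  have hA := opMatNorm_nonneg A
  rw [opMatNorm_le_iff _ (by positivity)]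
  intro v
  simp only [Matrix.smul_apply, smul_apply, ← Finset.smul_sum, norm_smul, mul_pow]
  rw [← Finset.mul_sum, mul_assoc]
  gcongr
  exact sum_norm_sq_le_opMatNorm A v

/-- A matrix over a space of operators is a contraction between `ℓ²`-sums. -/
def IsContr {X : Submodule ℂ (H →L[ℂ] H)} {ι κ : Type} [Fintype ι] [Fintype κ]
    (T : Matrix ι κ X) : Prop :=
  ∀ v : κ → H, ∑ i, ‖∑ j, (T i j : H →L[ℂ] H) (v j)‖ ^ 2 ≤ ∑ j, ‖v j‖ ^ 2

theorem isContr_iff {X : Submodule ℂ (H →L[ℂ] H)} {ι κ : Type} [Fintype ι] [Fintype κ]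
    (T : Matrix ι κ X) : IsContr T ↔ subMatNorm T ≤ 1 := by
  unfold subMatNorm
  rw [opMatNorm_le_iff _ zero_le_one]
  simp [IsContr]

/-- A scalar matrix is a contraction between `ℓ²`-spaces. -/
def IsScalarContr {ι κ : Type} [Fintype ι] [Fintype κ] (G : Matrix ι κ ℂ) : Prop :=
  ∀ v : κ → ℂ, ∑ i, ‖∑ j, G i j * v j‖ ^ 2 ≤ ∑ j, ‖v j‖ ^ 2

theorem IsScalarContr.sum_norm_sq_le {ι κ : Type} [Fintype ι] [Fintype κ] {G : Matrix ι κ ℂ}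
    (hG : IsScalarContr G) (w : κ → H) :
    ∑ i, ‖∑ j, G i j • w j‖ ^ 2 ≤ ∑ j, ‖w j‖ ^ 2 := by
  let S : Submodule ℂ H := Submodule.span ℂ (Set.range w)
  have : FiniteDimensional ℂ S := FiniteDimensional.span_of_finite ℂ (Set.finite_range w)
  let b := stdOrthonormalBasis ℂ S
  let w' : κ → S := fun j => ⟨w j, Submodule.subset_span ⟨j, rfl⟩⟩
  have h1 : ∀ i, ‖∑ j, G i j • w j‖ ^ 2 = ∑ l, ‖∑ j, G i j * inner ℂ (b l) (w' j)‖ ^ 2 := by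
    intro i
    have : ‖∑ j, G i j • w j‖ = ‖∑ j, G i j • w' j‖ := by
      change _ = ‖((∑ j, G i j • w' j : S) : H)‖
      simp [w']
    rw [this, ← b.sum_sq_norm_inner_right]
    simp [inner_sum, inner_smul_right]
  have h2 : ∀ j, ‖w j‖ ^ 2 = ∑ l, ‖inner ℂ (b l) (w' j)‖ ^ 2 := by
    intro j
    rw [b.sum_sq_norm_inner_right]
    rfl
  simp only [h1, h2]
  rw [Finset.sum_comm, Finset.sum_comm (s := (Finset.univ : Finset κ))]
  exact Finset.sum_le_sum fun l _ => hG _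

theorem IsScalarContr.isContr {X : Submodule ℂ (H →L[ℂ] H)} {e : X}
    (he : ‖(e : H →L[ℂ] H)‖ = 1) {ι κ : Type} [Fintype ι] [Fintype κ] {G : Matrix ι κ ℂ}
    (hG : IsScalarContr G) : IsContr (G.map (fun z => z • e)) := by
  intro v
  have := hG.sum_norm_sq_le (fun j => (e : H →L[ℂ] H) (v j))
  refine le_trans (by simpa using this) (Finset.sum_le_sum fun j _ => ?_)
  gcongr
  simpa [he] using (e : H →L[ℂ] H).le_opNorm (v j)

theorem isScalarContr_reindex {ι κ : Type} [Fintype ι] [Fintype κ] [DecidableEq κ] {σ : ι → κ}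
    (hσ : Function.Injective σ) :
    IsScalarContr (Matrix.of fun i j => if σ i = j then (1 : ℂ) else 0) := by
  intro v
  simp only [Matrix.of_apply, ite_mul, one_mul, zero_mul, Finset.sum_ite_eq, Finset.mem_univ,
    if_true]
  have := Finset.sum_map Finset.univ ⟨σ, hσ⟩ (fun j => ‖v j‖ ^ 2)
  simp only [Function.Embedding.coeFn_mk] at this
  rw [← this]
  exact Finset.sum_le_univ_sum_of_nonneg fun j => by positivity

/-- The column `(a, b)` of scalar multiples of the identity. -/
theorem isScalarContr_column {κ : Type} [Fintype κ] [DecidableEq κ] {a b : ℂ}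
    (h : ‖a‖ ^ 2 + ‖b‖ ^ 2 ≤ 1) :
    IsScalarContr (Matrix.fromRows (a • (1 : Matrix κ κ ℂ)) (b • (1 : Matrix κ κ ℂ))) := by
  intro v
  simp only [Fintype.sum_sum_type, Matrix.fromRows_apply_inl, Matrix.fromRows_apply_inr,
    Matrix.smul_apply, Matrix.one_apply, smul_eq_mul, mul_ite, mul_one, mul_zero, ite_mul,
    zero_mul, Finset.sum_ite_eq, Finset.mem_univ, if_true, norm_mul, mul_pow]
  rw [← Finset.mul_sum, ← Finset.mul_sum, ← add_mul]
  exact mul_le_of_le_one_left (Finset.sum_nonneg fun _ _ => by positivity) h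

theorem norm_add_sq_le_of_row {a b x y : ℂ} (h : ‖a‖ ^ 2 + ‖b‖ ^ 2 ≤ 1) :
    ‖a * x + b * y‖ ^ 2 ≤ ‖x‖ ^ 2 + ‖y‖ ^ 2 := by
  have h1 : ‖a * x + b * y‖ ≤ ‖a‖ * ‖x‖ + ‖b‖ * ‖y‖ := by
    simpa using norm_add_le (a * x) (b * y)
  calc ‖a * x + b * y‖ ^ 2 ≤ (‖a‖ * ‖x‖ + ‖b‖ * ‖y‖) ^ 2 := by gcongr
    _ ≤ (‖a‖ ^ 2 + ‖b‖ ^ 2) * (‖x‖ ^ 2 + ‖y‖ ^ 2) := by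
      nlinarith [sq_nonneg (‖a‖ * ‖y‖ - ‖b‖ * ‖x‖)]
    _ ≤ _ := mul_le_of_le_one_left (by positivity) h

/-- The row `(a, b)` of scalar multiples of the identity. -/
theorem isScalarContr_row {κ : Type} [Fintype κ] [DecidableEq κ] {a b : ℂ}
    (h : ‖a‖ ^ 2 + ‖b‖ ^ 2 ≤ 1) :
    IsScalarContr (Matrix.fromCols (a • (1 : Matrix κ κ ℂ)) (b • (1 : Matrix κ κ ℂ))) := by
  intro v
  simp only [Fintype.sum_sum_type, Matrix.fromCols_apply_inl, Matrix.fromCols_apply_inr,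
    Matrix.smul_apply, Matrix.one_apply, smul_eq_mul, mul_ite, mul_one, mul_zero, ite_mul,
    zero_mul, Finset.sum_ite_eq, Finset.mem_univ, if_true]
  rw [← Finset.sum_add_distrib]
  exact Finset.sum_le_sum fun j _ => norm_add_sq_le_of_row h

/-- Douglas factorization for finite families in a complex vector space. -/
theorem exists_isScalarContr_of_dual_le {E : Type} [AddCommGroup E] [Module ℂ E]
    {α β : Type} [Fintype α] [Fintype β] (a : α → E) (b : β → E)
    (h : ∀ φ : Module.Dual ℂ E, ∑ i, ‖φ (b i)‖ ^ 2 ≤ ∑ j, ‖φ (a j)‖ ^ 2) :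
    ∃ G : Matrix β α ℂ, IsScalarContr G ∧ ∀ i, b i = ∑ j, G i j • a j := by
  classical
  let ev : ∀ {γ : Type} [Fintype γ], (γ → E) → (Module.Dual ℂ E →ₗ[ℂ] EuclideanSpace ℂ γ) :=
    fun c => (WithLp.linearEquiv 2 ℂ _).symm.toLinearMap ∘ₗ
      LinearMap.pi fun i => Module.Dual.eval ℂ E (c i)
  have hev : ∀ {γ : Type} [Fintype γ] (c : γ → E) φ, ‖ev c φ‖ ^ 2 = ∑ i, ‖φ (c i)‖ ^ 2 := by
    intro γ _ c φ
    rw [EuclideanSpace.norm_sq_eq]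
    rfl
  have hle : ∀ φ, ‖ev b φ‖ ≤ ‖ev a φ‖ := fun φ => by
    rw [← sq_le_sq₀ (norm_nonneg _) (norm_nonneg _), hev, hev]
    exact h φ
  have hker : LinearMap.ker (ev a) ≤ LinearMap.ker (ev b) := by
    intro φ hφ
    rw [LinearMap.mem_ker] at hφ ⊢
    simpa [hφ] using hle φ
  obtain ⟨L, hL⟩ : ∃ L : EuclideanSpace ℂ α →ₗ[ℂ] EuclideanSpace ℂ β, L ∘ₗ ev a = ev b := by
    obtain ⟨g, hg⟩ := ((LinearMap.ker (ev a)).liftQ (ev a) le_rfl).exists_leftInverse_of_injective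
      (Submodule.ker_liftQ_eq_bot _ _ _ le_rfl)
    refine ⟨(LinearMap.ker (ev a)).liftQ (ev b) hker ∘ₗ g, LinearMap.ext fun φ => ?_⟩
    have := LinearMap.congr_fun hg ((LinearMap.ker (ev a)).mkQ φ)
    simp only [LinearMap.comp_apply, Submodule.mkQ_apply, Submodule.liftQ_apply,
      LinearMap.id_apply] at this
    simp [this]
  let S := LinearMap.range (ev a)
  let Q : EuclideanSpace ℂ α →ₗ[ℂ] EuclideanSpace ℂ β := L ∘ₗ S.starProjection.toLinearMap
  have hQ : ∀ v, ‖Q v‖ ≤ ‖v‖ := by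
    intro v
    obtain ⟨φ, hφ⟩ : S.starProjection v ∈ S := Submodule.starProjection_apply_mem S v
    have : Q v = ev b φ := by
      rw [← hL]
      simp [Q, hφ]
    rw [this]
    refine (hle φ).trans ?_
    rw [hφ]
    exact Submodule.norm_starProjection_apply_le S v
  have hQev : ∀ φ, Q (ev a φ) = ev b φ := by
    intro φ
    have : S.starProjection (ev a φ) = ev a φ :=
      Submodule.starProjection_eq_self_iff.2 ⟨φ, rfl⟩
    rw [← hL]
    simp [Q, this]
  let G : Matrix β α ℂ := Matrix.toEuclideanLin.symm Q
  have hGQ : ∀ v i, (Q v) i = ∑ j, G i j * v j := by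
    intro v i
    have : Q = Matrix.toEuclideanLin G := by simp [G]
    rw [this]
    simp [Matrix.toLpLin_apply, Matrix.mulVec, dotProduct]
  refine ⟨G, ?_, ?_⟩
  · intro v
    have := hQ (WithLp.toLp 2 v)
    rw [← sq_le_sq₀ (norm_nonneg _) (norm_nonneg _), EuclideanSpace.norm_sq_eq,
      EuclideanSpace.norm_sq_eq] at this
    simpa only [hGQ] using this
  · intro i
    rw [← sub_eq_zero, ← Module.forall_dual_apply_eq_zero_iff ℂ]
    intro φ
    have := congrArg (fun w => w i) (hQev φ)
    simp only [hGQ] at this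
    rw [map_sub, map_sum, sub_eq_zero]
    simp only [map_smul, smul_eq_mul]
    exact this.symm

theorem isContr_normalize {X : Submodule ℂ (H →L[ℂ] H)} (x : X) :
    IsContr (Matrix.of fun _ _ : Unit =>
      ((1 / (1 + ‖(x : H →L[ℂ] H)‖) : ℝ) : ℂ) • x) := by
  have hx := norm_nonneg (x : H →L[ℂ] H)
  obtain ⟨t, ht, htx⟩ : ∃ t : ℝ, 0 < t ∧ t = 1 / (1 + ‖(x : H →L[ℂ] H)‖) :=
    ⟨_, by positivity, rfl⟩
  rw [← htx]
  intro v
  simp only [Finset.univ_unique, Finset.sum_singleton, Matrix.of_apply, Submodule.coe_smul,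
    smul_apply, norm_smul, Complex.norm_real, Real.norm_of_nonneg ht.le]
  gcongr
  calc t * ‖(x : H →L[ℂ] H) (v default)‖ ≤ t * (‖(x : H →L[ℂ] H)‖ * ‖v default‖) := by
        gcongr
        exact (x : H →L[ℂ] H).le_opNorm _
    _ = (t * ‖(x : H →L[ℂ] H)‖) * ‖v default‖ := by ring
    _ ≤ 1 * ‖v default‖ := by
        gcongr
        rw [htx, div_mul_eq_mul_div, one_mul, div_le_one (by positivity)]
        linarith
    _ = _ := one_mul _

end Contractions

section Reachable

omit [CompleteSpace H]

/-- The families obtained from the family `I` by successively applying contractive matrices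
over the operator space `X`, which acts on `M` through `act`. -/
inductive Reachable {X : Submodule ℂ (H →L[ℂ] H)} {M : Type} [AddCommGroup M] [Module ℂ M]
    (act : X →ₗ[ℂ] M →ₗ[ℂ] M) {κ : Type} [Fintype κ] (I : κ → M) :
    ∀ {ι : Type} [Fintype ι], (ι → M) → Prop
  | base : Reachable act I I
  | app {ι μ : Type} [Fintype ι] [Fintype μ] {T : Matrix ι μ X} {f : μ → M} :
      IsContr T → Reachable act I f → Reachable act I (fun i => ∑ j, act (T i j) (f j))

variable {X : Submodule ℂ (H →L[ℂ] H)} {e : X} {M : Type} [AddCommGroup M] [Module ℂ M]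
  {act : X →ₗ[ℂ] M →ₗ[ℂ] M} {κ : Type} [Fintype κ] {I : κ → M}
  {ι μ ρ : Type} [Fintype ι] [Fintype μ] [Fintype ρ]

theorem Reachable.unit_act (hact : ∀ x u, act e (act x u) = act x u)
    (hI : ∀ j, act e (I j) = I j) {f : ι → M} (hf : Reachable act I f) (i : ι) :
    act e (f i) = f i := by
  induction hf with
  | base => exact hI i
  | app => simp [hact]

theorem Reachable.scalar (he : ‖(e : H →L[ℂ] H)‖ = 1)
    (hact : ∀ x u, act e (act x u) = act x u) (hI : ∀ j, act e (I j) = I j)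
    {G : Matrix ι μ ℂ} (hG : IsScalarContr G) {f : μ → M} (hf : Reachable act I f) :
    Reachable act I (fun i => ∑ j, G i j • f j) := by
  simpa [hf.unit_act hact hI] using hf.app (hG.isContr he)

theorem Reachable.reindex (he : ‖(e : H →L[ℂ] H)‖ = 1)
    (hact : ∀ x u, act e (act x u) = act x u) (hI : ∀ j, act e (I j) = I j)
    {f : μ → M} (hf : Reachable act I f) {σ : ι → μ} (hσ : Function.Injective σ) :
    Reachable act I (fun i => f (σ i)) := by
  classical
  simpa using hf.scalar he hact hI (isScalarContr_reindex hσ)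

theorem Reachable.app_left (he : ‖(e : H →L[ℂ] H)‖ = 1)
    (hact : ∀ x u, act e (act x u) = act x u) (hI : ∀ j, act e (I j) = I j)
    {T : Matrix ι μ X} (hT : IsContr T) {f : μ → M} {h : ρ → M}
    (hf : Reachable act I (Sum.elim f h)) :
    Reachable act I (Sum.elim (fun i => ∑ j, act (T i j) (f j)) h) := by
  classical
  have hT' : IsContr (Matrix.fromBlocks T 0 0 (Matrix.of fun i j : ρ => if i = j then e else 0)) := by
    intro v
    rw [Fintype.sum_sum_type, Fintype.sum_sum_type]
    simp only [Fintype.sum_sum_type, Matrix.fromBlocks_apply₁₁, Matrix.fromBlocks_apply₁₂,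
      Matrix.fromBlocks_apply₂₁, Matrix.fromBlocks_apply₂₂, Matrix.zero_apply, Matrix.of_apply,
      ZeroMemClass.coe_zero, zero_apply, Finset.sum_const_zero, add_zero, zero_add]
    refine add_le_add (hT _) (Finset.sum_le_sum fun j _ => ?_)
    rw [Finset.sum_eq_single j (by intro b _ hb; simp [hb.symm]) (by simp)]
    gcongr
    simpa [he] using (e : H →L[ℂ] H).le_opNorm (v (Sum.inr j))
  convert hf.app hT' using 1
  funext i
  rcases i with i | i
  · simp
  · simp only [Sum.elim_inr, Fintype.sum_sum_type, Matrix.fromBlocks_apply₂₁,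
      Matrix.fromBlocks_apply₂₂, Matrix.zero_apply, Matrix.of_apply, Sum.elim_inl, map_zero,
      LinearMap.zero_apply, Finset.sum_const_zero, zero_add]
    rw [Finset.sum_eq_single i (by intro b _ hb; simp [hb.symm]) (by simp), if_pos rfl]
    exact (hf.unit_act hact hI (Sum.inr i)).symm

theorem Reachable.scalar_left (he : ‖(e : H →L[ℂ] H)‖ = 1)
    (hact : ∀ x u, act e (act x u) = act x u) (hI : ∀ j, act e (I j) = I j)
    {G : Matrix ι μ ℂ} (hG : IsScalarContr G) {f : μ → M} {h : ρ → M}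
    (hf : Reachable act I (Sum.elim f h)) :
    Reachable act I (Sum.elim (fun i => ∑ j, G i j • f j) h) := by
  have := hf.app_left he hact hI (hG.isContr he)
  have hfix : ∀ j, act e (f j) = f j := fun j => hf.unit_act hact hI (Sum.inl j)
  simpa [hfix] using this

theorem Reachable.split_left (he : ‖(e : H →L[ℂ] H)‖ = 1)
    (hact : ∀ x u, act e (act x u) = act x u) (hI : ∀ j, act e (I j) = I j)
    {f : μ → M} {h : ρ → M} (hf : Reachable act I (Sum.elim f h)) {a b : ℂ}
    (hab : ‖a‖ ^ 2 + ‖b‖ ^ 2 ≤ 1) :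
    Reachable act I (Sum.elim (Sum.elim (a • f) (b • f)) h) := by
  classical
  convert hf.scalar_left he hact hI (isScalarContr_column (κ := μ) hab) using 2
  funext i
  rcases i with i | i <;> simp [Matrix.one_apply]

theorem Reachable.split (he : ‖(e : H →L[ℂ] H)‖ = 1)
    (hact : ∀ x u, act e (act x u) = act x u) (hI : ∀ j, act e (I j) = I j)
    {f : μ → M} (hf : Reachable act I f) {a b : ℂ} (hab : ‖a‖ ^ 2 + ‖b‖ ^ 2 ≤ 1) :
    Reachable act I (Sum.elim (a • f) (b • f)) := by
  classical
  convert hf.scalar he hact hI (isScalarContr_column (κ := μ) hab) using 1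
  funext i
  rcases i with i | i <;> simp [Matrix.one_apply]

theorem Reachable.merge_left (he : ‖(e : H →L[ℂ] H)‖ = 1)
    (hact : ∀ x u, act e (act x u) = act x u) (hI : ∀ j, act e (I j) = I j)
    {f g : μ → M} {h : ρ → M} (hf : Reachable act I (Sum.elim (Sum.elim f g) h)) {a b : ℂ}
    (hab : ‖a‖ ^ 2 + ‖b‖ ^ 2 ≤ 1) :
    Reachable act I (Sum.elim (a • f + b • g) h) := by
  classical
  convert hf.scalar_left he hact hI (isScalarContr_row (κ := μ) hab) using 2
  funext i
  simp [Matrix.one_apply]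

theorem Reachable.merge (he : ‖(e : H →L[ℂ] H)‖ = 1)
    (hact : ∀ x u, act e (act x u) = act x u) (hI : ∀ j, act e (I j) = I j)
    {f g : μ → M} (hf : Reachable act I (Sum.elim f g)) {a b : ℂ}
    (hab : ‖a‖ ^ 2 + ‖b‖ ^ 2 ≤ 1) :
    Reachable act I (a • f + b • g) := by
  classical
  convert hf.scalar he hact hI (isScalarContr_row (κ := μ) hab) using 1
  funext i
  simp [Matrix.one_apply]

theorem Reachable.swap (he : ‖(e : H →L[ℂ] H)‖ = 1)
    (hact : ∀ x u, act e (act x u) = act x u) (hI : ∀ j, act e (I j) = I j)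
    {f : ι → M} {g : μ → M} (hf : Reachable act I (Sum.elim f g)) :
    Reachable act I (Sum.elim g f) := by
  convert hf.reindex he hact hI (Equiv.sumComm μ ι).injective using 1
  funext i
  rcases i with i | i <;> rfl

theorem Reachable.swap_left (he : ‖(e : H →L[ℂ] H)‖ = 1)
    (hact : ∀ x u, act e (act x u) = act x u) (hI : ∀ j, act e (I j) = I j)
    {f : ι → M} {g : μ → M} {h : ρ → M} (hf : Reachable act I (Sum.elim (Sum.elim f g) h)) :
    Reachable act I (Sum.elim (Sum.elim g f) h) := by
  convert hf.reindex he hact hI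
    ((Equiv.sumComm μ ι).sumCongr (Equiv.refl ρ)).injective using 1
  funext i
  rcases i with (i | i) | i <;> rfl

theorem Reachable.assoc_symm (he : ‖(e : H →L[ℂ] H)‖ = 1)
    (hact : ∀ x u, act e (act x u) = act x u) (hI : ∀ j, act e (I j) = I j)
    {f : ι → M} {g : μ → M} {h : ρ → M} (hf : Reachable act I (Sum.elim f (Sum.elim g h))) :
    Reachable act I (Sum.elim (Sum.elim f g) h) := by
  convert hf.reindex he hact hI (Equiv.sumAssoc ι μ ρ).injective using 1
  funext i
  rcases i with (i | i) | i <;> rfl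

theorem Reachable.left (he : ‖(e : H →L[ℂ] H)‖ = 1)
    (hact : ∀ x u, act e (act x u) = act x u) (hI : ∀ j, act e (I j) = I j)
    {f : ι → M} {g : μ → M} (hf : Reachable act I (Sum.elim f g)) : Reachable act I f :=
  hf.reindex he hact hI Sum.inl_injective

theorem Reachable.smul (he : ‖(e : H →L[ℂ] H)‖ = 1)
    (hact : ∀ x u, act e (act x u) = act x u) (hI : ∀ j, act e (I j) = I j)
    {f : ι → M} (hf : Reachable act I f) {a : ℂ} (ha : ‖a‖ ≤ 1) : Reachable act I (a • f) :=
  (hf.split he hact hI (a := a) (b := 0) (by simpa using ha)).left he hact hI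

/-- A scaled copy of the base family may be replaced by the scaled copy of any reachable one. -/
theorem Reachable.replace (he : ‖(e : H →L[ℂ] H)‖ = 1)
    (hact : ∀ x u, act e (act x u) = act x u) (hI : ∀ j, act e (I j) = I j)
    {f : ι → M} (hf : Reachable act I f) {h : ρ → M} {c : ℂ}
    (hc : Reachable act I (Sum.elim (c • I) h)) : Reachable act I (Sum.elim (c • f) h) := by
  induction hf with
  | base => exact hc
  | app hT _ ih =>
    convert ih.app_left he hact hI hT using 2
    funext i
    simp [Finset.smul_sum]

/-- Stacking two reachable families, up to a factor. -/
theorem Reachable.stack (he : ‖(e : H →L[ℂ] H)‖ = 1)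
    (hact : ∀ x u, act e (act x u) = act x u) (hI : ∀ j, act e (I j) = I j)
    {f : ι → M} {g : μ → M} (hf : Reachable act I f) (hg : Reachable act I g) {a b : ℂ}
    (hab : ‖a‖ ^ 2 + ‖b‖ ^ 2 ≤ 1) : Reachable act I (Sum.elim (a • f) (b • g)) := by
  have h0 : Reachable act I (Sum.elim (a • I) (b • I)) :=
    (Reachable.base (act := act) (I := I)).split he hact hI hab
  have h1 := hf.replace he hact hI h0
  exact (hg.replace he hact hI (h1.swap he hact hI)).swap he hact hI

/-- A nonzero multiple of the family is reachable. -/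
def BoundedFamily (act : X →ₗ[ℂ] M →ₗ[ℂ] M) (I : κ → M) (f : ι → M) : Prop :=
  ∃ c : ℂ, c ≠ 0 ∧ Reachable act I (c • f)

theorem BoundedFamily.elim (he : ‖(e : H →L[ℂ] H)‖ = 1)
    (hact : ∀ x u, act e (act x u) = act x u) (hI : ∀ j, act e (I j) = I j)
    {f : ι → M} {g : μ → M} (hf : BoundedFamily act I f) (hg : BoundedFamily act I g) :
    BoundedFamily act I (Sum.elim f g) := by
  obtain ⟨c, hc, hf⟩ := hf
  obtain ⟨d, hd, hg⟩ := hg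
  let t : ℝ := 1 / (1 + ‖c‖ + ‖d‖)
  have hcn := norm_nonneg c
  have hdn := norm_nonneg d
  have ht : 0 < t := by positivity
  have htn : ‖(t : ℂ)‖ = t := by simp [abs_of_pos ht]
  have h1 : ‖(t : ℂ) * d‖ ^ 2 + ‖(t : ℂ) * c‖ ^ 2 ≤ 1 := by
    rw [norm_mul, norm_mul, htn]
    have : t * (1 + ‖c‖ + ‖d‖) = 1 := by
      simp only [t]
      field_simp
    nlinarith [mul_nonneg ht.le hcn, mul_nonneg ht.le hdn,
      mul_nonneg (mul_nonneg ht.le hcn) (mul_nonneg ht.le hdn)]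
  refine ⟨t * c * d, by simp [hc, hd, ht.ne'], ?_⟩
  convert hf.stack he hact hI hg h1 using 1
  funext i
  rcases i with i | i
  · simp only [Pi.smul_apply, Sum.elim_inl, smul_smul]
    congr 1
    ring
  · simp only [Pi.smul_apply, Sum.elim_inr, smul_smul]

theorem boundedFamily_of_forall (he : ‖(e : H →L[ℂ] H)‖ = 1)
    (hact : ∀ x u, act e (act x u) = act x u) (hI : ∀ j, act e (I j) = I j)
    {f : ι → M} (hf : ∀ i, BoundedFamily act I (fun _ : Unit => f i)) :
    BoundedFamily act I f := by
  refine Fintype.induction_empty_option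
    (P := fun ι _ => ∀ f : ι → M, (∀ i, BoundedFamily act I (fun _ : Unit => f i)) →
      BoundedFamily act I f) ?_ ?_ ?_ ι f hf
  · intro α β _ σ ih f hf
    let _ := Fintype.ofEquiv β σ.symm
    obtain ⟨c, hc, h⟩ := ih (fun i => f (σ i)) fun i => hf (σ i)
    refine ⟨c, hc, ?_⟩
    convert h.reindex he hact hI σ.symm.injective using 1
    funext i
    simp
  · intro f _
    refine ⟨1, one_ne_zero, ?_⟩
    convert (Reachable.base (act := act) (I := I)).reindex he hact hI
      (Function.injective_of_subsingleton (PEmpty.elim : PEmpty → κ)) using 1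
    exact Subsingleton.elim _ _
  · intro α _ ih f hf
    obtain ⟨c, hc, h⟩ := (ih (fun i => f (some i)) fun i => hf (some i)).elim he hact hI (hf none)
    refine ⟨c, hc, ?_⟩
    convert h.reindex he hact hI (Equiv.optionEquivSumPUnit α).injective using 1
    funext i
    rcases i with _ | i <;> rfl

theorem Reachable.bounded (he : ‖(e : H →L[ℂ] H)‖ = 1)
    (hact : ∀ x u, act e (act x u) = act x u) (hI : ∀ j, act e (I j) = I j)
    {f : ι → M} (hf : Reachable act I f) (i : ι) : BoundedFamily act I (fun _ : Unit => f i) := by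
  refine ⟨1, one_ne_zero, ?_⟩
  convert hf.reindex he hact hI
    (Function.injective_of_subsingleton (fun _ : Unit => i)) using 1
  funext _
  simp

/-- The submodule of vectors a nonzero multiple of which is reachable. -/
def boundedSubmodule (he : ‖(e : H →L[ℂ] H)‖ = 1)
    (hact : ∀ x u, act e (act x u) = act x u) (hI : ∀ j, act e (I j) = I j) :
    Submodule ℂ M where
  carrier := {u | BoundedFamily act I (fun _ : Unit => u)}
  add_mem' := by
    intro u v hu hv
    obtain ⟨c, hc, h⟩ := BoundedFamily.elim he hact hI hu hv
    have h' : Reachable act I (Sum.elim (fun _ : Unit => c • u) (fun _ : Unit => c • v)) := by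
      convert h using 1
      funext i
      rcases i with i | i <;> rfl
    refine ⟨(1 / 2) * c, by simp [hc], ?_⟩
    convert h'.merge he hact hI (a := 1 / 2) (b := 1 / 2) (by norm_num) using 1
    funext i
    simp [mul_smul]
  zero_mem' := by
    refine ⟨1, one_ne_zero, ?_⟩
    have := (boundedFamily_of_forall (act := act) (I := I) he hact hI
      (f := (PEmpty.elim : PEmpty → M)) (fun i => i.elim))
    obtain ⟨c, -, h⟩ := this
    have h0 : IsScalarContr (0 : Matrix Unit PEmpty ℂ) := fun v => by simp
    simpa using h.scalar he hact hI h0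
  smul_mem' := by
    intro z u hu
    obtain ⟨c, hc, h⟩ := hu
    have hz := norm_nonneg z
    refine ⟨c * ((1 / (1 + ‖z‖) : ℝ) : ℂ), mul_ne_zero hc ?_, ?_⟩
    · rw [Ne, Complex.ofReal_eq_zero]
      positivity
    · convert h.smul he hact hI (a := ((1 / (1 + ‖z‖) : ℝ) : ℂ) * z) ?_ using 1
      · funext i
        simp only [Pi.smul_apply, smul_smul]
        congr 1
        ring
      · rw [norm_mul, Complex.norm_real, Real.norm_of_nonneg (by positivity), div_mul_eq_mul_div,
          one_mul, div_le_one (by positivity)]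
        linarith

theorem act_mem_boundedSubmodule (he : ‖(e : H →L[ℂ] H)‖ = 1)
    (hact : ∀ x u, act e (act x u) = act x u) (hI : ∀ j, act e (I j) = I j) (x : X) {u : M}
    (hu : u ∈ boundedSubmodule he hact hI) : act x u ∈ boundedSubmodule he hact hI := by
  obtain ⟨c, hc, h⟩ := hu
  have hx := norm_nonneg (x : H →L[ℂ] H)
  let t : ℝ := 1 / (1 + ‖(x : H →L[ℂ] H)‖)
  have ht : 0 < t := by positivity
  have hT : IsContr (Matrix.of fun _ _ : Unit => (t : ℂ) • x) := isContr_normalize x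
  refine ⟨t * c, mul_ne_zero (by exact_mod_cast ht.ne') hc, ?_⟩
  convert h.app hT using 1
  funext i
  simp only [Finset.univ_unique, Finset.sum_singleton, Matrix.of_apply, map_smul,
    LinearMap.smul_apply, Pi.smul_apply, smul_smul]
  rw [mul_comm]

/-- Feeding back `f` along `A = G₁₁ I' + G₁₂ T f`, `f = G₂₁ I' + G₂₂ T f` through `N` steps. -/
theorem Reachable.feedback (he : ‖(e : H →L[ℂ] H)‖ = 1)
    (hact : ∀ x u, act e (act x u) = act x u) (hI : ∀ j, act e (I j) = I j)
    {ν α β : Type} [Fintype ν] [Fintype α] [Fintype β]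
    {T : Matrix α β X} (hT : IsContr T) {G : Matrix (ν ⊕ β) (μ ⊕ α) ℂ} (hG : IsScalarContr G)
    {I' : μ → M} {f : β → M} {A : ν → M}
    (hAf : ∀ i, Sum.elim A f i =
      ∑ j, G i j • Sum.elim I' (fun i => ∑ j, act (T i j) (f j)) j)
    (N : ℕ) : ∀ {ρ : Type} [Fintype ρ] {h : ρ → M},
      Reachable act I (Sum.elim (((√N : ℝ) : ℂ) • I') (Sum.elim f h)) →
      Reachable act I (Sum.elim (((√N : ℝ) : ℂ) • A) (Sum.elim f h)) := by
  induction N with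
  | zero =>
    intro ρ _ h hr
    have h0 : IsScalarContr (0 : Matrix ν μ ℂ) := fun v => by
      simp only [Matrix.zero_apply, zero_mul, Finset.sum_const_zero, norm_zero]
      norm_num
      positivity
    convert hr.scalar_left he hact hI h0 using 2
    funext i
    simp
  | succ N ih =>
    intro ρ _ h hr
    have hN : (0 : ℝ) < ((N + 1 : ℕ) : ℝ) := by positivity
    have hs : √((N + 1 : ℕ) : ℝ) ≠ 0 := (Real.sqrt_pos.2 hN).ne'
    have hab : ‖((1 / √((N + 1 : ℕ) : ℝ) : ℝ) : ℂ)‖ ^ 2 +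
        ‖((√N / √((N + 1 : ℕ) : ℝ) : ℝ) : ℂ)‖ ^ 2 ≤ 1 := by
      rw [Complex.norm_real, Complex.norm_real, Real.norm_eq_abs, Real.norm_eq_abs, sq_abs, sq_abs,
        div_pow, div_pow, Real.sq_sqrt hN.le, Real.sq_sqrt (Nat.cast_nonneg N), ← add_div,
        div_le_one hN]
      push_cast
      linarith
    have h1 := hr.split_left he hact hI hab
    have e1 : ((1 / √((N + 1 : ℕ) : ℝ) : ℝ) : ℂ) • ((√((N + 1 : ℕ) : ℝ) : ℝ) : ℂ) • I' = I' := by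
      rw [smul_smul, ← Complex.ofReal_mul, one_div_mul_cancel hs, Complex.ofReal_one, one_smul]
    have e2 : ((√N / √((N + 1 : ℕ) : ℝ) : ℝ) : ℂ) • ((√((N + 1 : ℕ) : ℝ) : ℝ) : ℂ) • I' =
        ((√N : ℝ) : ℂ) • I' := by
      rw [smul_smul, ← Complex.ofReal_mul, div_mul_cancel₀ _ hs]
    rw [e1, e2] at h1
    have h2 : Reachable act I
        (Sum.elim (((√N : ℝ) : ℂ) • I') (Sum.elim f (Sum.elim I' h))) := by
      convert h1.reindex he hact hI (ι := μ ⊕ (β ⊕ (μ ⊕ ρ)))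
        (σ := Sum.elim (Sum.inl ∘ Sum.inr) (Sum.elim (Sum.inr ∘ Sum.inl)
          (Sum.elim (Sum.inl ∘ Sum.inl) (Sum.inr ∘ Sum.inr)))) ?_ using 1
      · funext i
        rcases i with i | i | i | i <;> rfl
      · rintro (a | a | a | a) (b | b | b | b) <;> simp
    have h3 : Reachable act I
        (Sum.elim f (Sum.elim I' (Sum.elim (((√N : ℝ) : ℂ) • A) h))) := by
      convert (ih h2).reindex he hact hI (ι := β ⊕ (μ ⊕ (ν ⊕ ρ)))
        (σ := Sum.elim (Sum.inr ∘ Sum.inl) (Sum.elim (Sum.inr ∘ Sum.inr ∘ Sum.inl)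
          (Sum.elim Sum.inl (Sum.inr ∘ Sum.inr ∘ Sum.inr)))) ?_ using 1
      · funext i
        rcases i with i | i | i | i <;> rfl
      · rintro (a | a | a | a) (b | b | b | b) <;> simp
    have h4 : Reachable act I
        (Sum.elim (Sum.elim I' (fun i => ∑ j, act (T i j) (f j)))
          (Sum.elim (((√N : ℝ) : ℂ) • A) h)) :=
      (((h3.app_left he hact hI hT).assoc_symm he hact hI).swap_left he hact hI)
    have h5 : Reachable act I
        (Sum.elim (Sum.elim A f) (Sum.elim (((√N : ℝ) : ℂ) • A) h)) := by
      convert h4.scalar_left he hact hI hG using 2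
      exact funext hAf
    have h6 : Reachable act I
        (Sum.elim (Sum.elim A (((√N : ℝ) : ℂ) • A)) (Sum.elim f h)) := by
      convert h5.reindex he hact hI (ι := (ν ⊕ ν) ⊕ (β ⊕ ρ))
        (σ := Sum.elim (Sum.elim (Sum.inl ∘ Sum.inl) (Sum.inr ∘ Sum.inl))
          (Sum.elim (Sum.inl ∘ Sum.inr) (Sum.inr ∘ Sum.inr))) ?_ using 1
      · funext i
        rcases i with (i | i) | i | i <;> rfl
      · rintro ((a | a) | a | a) ((b | b) | b | b) <;> simp
    convert h6.merge_left he hact hI hab using 2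
    rw [smul_smul, ← Complex.ofReal_mul, ← add_smul, ← Complex.ofReal_add]
    congr 2
    field_simp
    rw [Real.sq_sqrt hN.le, Real.sq_sqrt (Nat.cast_nonneg N)]
    push_cast
    ring

/-- The transfer function of a contractive system with bounded state is approximately
reachable. -/
theorem Reachable.transfer (he : ‖(e : H →L[ℂ] H)‖ = 1)
    (hact : ∀ x u, act e (act x u) = act x u) (hI : ∀ j, act e (I j) = I j)
    {ν α β : Type} [Fintype ν] [Fintype α] [Fintype β]
    {T : Matrix α β X} (hT : IsContr T) {G : Matrix (ν ⊕ β) (κ ⊕ α) ℂ} (hG : IsScalarContr G)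
    {f : β → M} {A : ν → M} (hf : BoundedFamily act I f)
    (hAf : ∀ i, Sum.elim A f i =
      ∑ j, G i j • Sum.elim I (fun i => ∑ j, act (T i j) (f j)) j)
    {t : ℝ} (ht0 : 0 ≤ t) (ht : t < 1) : Reachable act I ((t : ℂ) • A) := by
  obtain ⟨c, hc, hr⟩ := hf
  have hcn : 0 < ‖c‖ := norm_pos_iff.2 hc
  let m : ℝ := 1 / ‖c‖ ^ 2
  have hm : 0 < m := by positivity
  obtain ⟨N, hN⟩ := exists_nat_gt (m * t ^ 2 / (1 - t ^ 2))
  have ht2 : 0 < 1 - t ^ 2 := by nlinarith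
  rw [div_lt_iff₀ ht2] at hN
  have hN0 : (0 : ℝ) ≤ N := Nat.cast_nonneg N
  obtain ⟨r, hr0, hr2⟩ : ∃ r : ℝ, 0 < r ∧ r ^ 2 * (N + m) = 1 := by
    refine ⟨1 / √(N + m), by positivity, ?_⟩
    rw [div_pow, Real.sq_sqrt (by positivity)]
    field_simp
  have hab : ‖((r * √N : ℝ) : ℂ)‖ ^ 2 + ‖(r : ℂ) / c‖ ^ 2 ≤ 1 := by
    rw [norm_div, Complex.norm_real, Complex.norm_real, Real.norm_eq_abs, Real.norm_eq_abs,
      abs_of_pos hr0, abs_of_nonneg (by positivity), mul_pow, Real.sq_sqrt hN0, div_pow]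
    have : r ^ 2 / ‖c‖ ^ 2 = r ^ 2 * m := by
      simp only [m]
      ring
    rw [this, ← mul_add, hr2]
  have h1 := (Reachable.base (act := act) (I := I)).stack he hact hI hr hab
  have e1 : ((r : ℂ) / c) • c • f = (r : ℂ) • f := by
    rw [smul_smul, div_mul_cancel₀ _ hc]
  have e2 : ∀ {γ : Type} (g : γ → M), ((r * √N : ℝ) : ℂ) • g = ((√N : ℝ) : ℂ) • (r : ℂ) • g := by
    intro γ g
    rw [smul_smul, ← Complex.ofReal_mul, mul_comm]
  rw [e1, e2] at h1
  have h2 : Reachable act I (Sum.elim (((√N : ℝ) : ℂ) • (r : ℂ) • I)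
      (Sum.elim ((r : ℂ) • f) (PEmpty.elim : PEmpty → M))) := by
    convert h1.reindex he hact hI (ι := κ ⊕ (β ⊕ PEmpty))
      (σ := Sum.elim Sum.inl (Sum.elim Sum.inr PEmpty.elim)) ?_ using 1
    · funext i
      rcases i with i | i | i
      · rfl
      · rfl
      · exact i.elim
    · rintro (a | a | a) (b | b | b) <;> first | exact a.elim | exact b.elim | simp
  have hAf' : ∀ i, Sum.elim ((r : ℂ) • A) ((r : ℂ) • f) i =
      ∑ j, G i j • Sum.elim ((r : ℂ) • I)
        (fun i => ∑ j, act (T i j) (((r : ℂ) • f) j)) j := by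
    intro i
    have := congrArg (fun u => (r : ℂ) • u) (hAf i)
    simp only [Finset.smul_sum] at this
    have hl : Sum.elim ((r : ℂ) • A) ((r : ℂ) • f) i = (r : ℂ) • Sum.elim A f i := by
      rcases i with i | i <;> rfl
    rw [hl, this]
    refine Finset.sum_congr rfl fun j _ => ?_
    rw [smul_comm]
    congr 1
    rcases j with j | j
    · rfl
    · simp [Finset.smul_sum]
  have h3 := (h2.feedback he hact hI hT hG hAf' N).left he hact hI
  rw [← e2] at h3
  have hrN : t ≤ r * √N := by
    refine le_of_sq_le_sq ?_ (by positivity)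
    rw [mul_pow, Real.sq_sqrt hN0]
    have : t ^ 2 * (N + m) ≤ N := by nlinarith
    calc t ^ 2 = t ^ 2 * (r ^ 2 * (N + m)) := by rw [hr2, mul_one]
      _ = r ^ 2 * (t ^ 2 * (N + m)) := by ring
      _ ≤ r ^ 2 * N := by gcongr
  rcases ht0.eq_or_lt with rfl | htpos
  · simpa using h3.smul he hact hI (a := 0) (by simp)
  · have hpos : 0 < r * √N := htpos.trans_le hrN
    convert h3.smul he hact hI (a := ((t / (r * √N) : ℝ) : ℂ)) ?_ using 1
    · rw [smul_smul, ← Complex.ofReal_mul, div_mul_cancel₀ _ hpos.ne']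
    · rw [Complex.norm_real, Real.norm_of_nonneg (by positivity)]
      exact (div_le_one hpos).2 hrN

end Reachable

section PositiveFunctional

omit [CompleteSpace H]

/-- A cone with an order unit `u` such that `-u` is not in the cone carries a positive
functional normalized at `u`. -/
theorem PointedCone.exists_positive_functional {W : Type*} [AddCommGroup W] [Module ℝ W]
    (C : PointedCone ℝ W) (u : W) (hunit : ∀ w, ∃ c : ℝ, c • u + w ∈ C) (hu : -u ∉ C) :
    ∃ s : W →ₗ[ℝ] ℝ, (∀ w ∈ C, 0 ≤ s w) ∧ s u = 1 := by
  have hu0 : u ≠ 0 := by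
    rintro rfl
    exact hu (by simp)
  have h1 : ∀ x : (LinearPMap.mkSpanSingleton u (1 : ℝ) hu0 : W →ₗ.[ℝ] ℝ).domain, (x : W) ∈ C →
      0 ≤ (LinearPMap.mkSpanSingleton u (1 : ℝ) hu0 : W →ₗ.[ℝ] ℝ) x := by
    rintro ⟨x, hx⟩ hxC
    obtain ⟨c, rfl⟩ := Submodule.mem_span_singleton.1 hx
    have : (LinearPMap.mkSpanSingleton u (1 : ℝ) hu0 : W →ₗ.[ℝ] ℝ) ⟨c • u, hx⟩ = c := by
      simpa using LinearPMap.mkSpanSingleton'_apply u (1 : ℝ) (σ := RingHom.id ℝ) _ c hx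
    rw [this]
    by_contra! hc
    apply hu
    have := C.smul_mem (r := -c⁻¹) (by simpa using hc.le) hxC
    simpa [smul_smul, hc.ne] using this
  have h2 : ∀ y, ∃ x : (LinearPMap.mkSpanSingleton u (1 : ℝ) hu0 : W →ₗ.[ℝ] ℝ).domain,
      (x : W) + y ∈ C := by
    intro y
    obtain ⟨c, hc⟩ := hunit y
    exact ⟨⟨c • u, Submodule.mem_span_singleton.2 ⟨c, rfl⟩⟩, hc⟩
  obtain ⟨s, hs, hpos⟩ := riesz_extension C _ h1 h2
  refine ⟨s, hpos, ?_⟩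
  rw [← LinearPMap.mkSpanSingleton_apply ℝ ℝ hu0 (1 : ℝ)]
  exact hs ⟨u, Submodule.mem_span_singleton_self u⟩

variable {X : Submodule ℂ (H →L[ℂ] H)} {E : Type} [AddCommGroup E] [Module ℂ E]

/-- The function `φ ↦ ∑ i, |φ (f i)|²` on the dual space. -/
def dualNormSq {ι : Type} [Fintype ι] (f : ι → E) : Module.Dual ℂ E → ℝ :=
  fun φ => ∑ i, ‖φ (f i)‖ ^ 2

/-- The cone of functions on the dual space generated by the nonnegative functions and the
differences `N(f) - N(T f)`, where `N = dualNormSq` and `T` is contractive over `X`. -/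
def contrCone (act : X →ₗ[ℂ] E →ₗ[ℂ] E) : PointedCone ℝ (Module.Dual ℂ E → ℝ) where
  carrier := {v | ∃ (p q : Type) (_ : Fintype p) (_ : Fintype q) (T : Matrix p q X) (f : q → E),
    IsContr T ∧ ∀ φ, dualNormSq f φ ≤ dualNormSq (fun i => ∑ j, act (T i j) (f j)) φ + v φ}
  add_mem' := by
    rintro v w ⟨p, q, _, _, T, f, hT, hv⟩ ⟨p', q', _, _, T', f', hT', hw⟩
    refine ⟨p ⊕ p', q ⊕ q', inferInstance, inferInstance, Matrix.fromBlocks T 0 0 T',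
      Sum.elim f f', ?_, fun φ => ?_⟩
    · intro x
      simpa using add_le_add (hT fun j => x (Sum.inl j)) (hT' fun j => x (Sum.inr j))
    · have h1 := hv φ
      have h2 := hw φ
      simp only [dualNormSq, Pi.add_apply, Fintype.sum_sum_type, Sum.elim_inl, Sum.elim_inr,
        Matrix.fromBlocks_apply₁₁, Matrix.fromBlocks_apply₁₂, Matrix.fromBlocks_apply₂₁,
        Matrix.fromBlocks_apply₂₂, Matrix.zero_apply, map_zero, LinearMap.zero_apply,
        Finset.sum_const_zero, add_zero, zero_add] at h1 h2 ⊢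
      linarith
  zero_mem' := ⟨Empty, Empty, inferInstance, inferInstance, 0, Empty.elim, fun x => by simp,
    fun φ => by simp [dualNormSq]⟩
  smul_mem' := by
    rintro ⟨c, hc⟩ v ⟨p, q, _, _, T, f, hT, hv⟩
    refine ⟨p, q, inferInstance, inferInstance, T, ((√c : ℝ) : ℂ) • f, hT, fun φ => ?_⟩
    have key : ∀ x : E, ‖φ (((√c : ℝ) : ℂ) • x)‖ ^ 2 = c * ‖φ x‖ ^ 2 := by
      intro x
      rw [map_smul, norm_smul, mul_pow, Complex.norm_real, Real.norm_eq_abs, sq_abs,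
        Real.sq_sqrt hc]
    have key2 : ∀ i, ∑ j, act (T i j) ((((√c : ℝ) : ℂ) • f) j) =
        ((√c : ℝ) : ℂ) • ∑ j, act (T i j) (f j) := by
      intro i
      simp [Finset.smul_sum]
    have h1 := mul_le_mul_of_nonneg_left (hv φ) hc
    rw [mul_add] at h1
    change _ ≤ _ + c * v φ
    simp only [dualNormSq, key2] at h1 ⊢
    simpa only [Pi.smul_apply, key, ← Finset.mul_sum] using h1

theorem mem_contrCone_of_nonneg (act : X →ₗ[ℂ] E →ₗ[ℂ] E) {v : Module.Dual ℂ E → ℝ}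
    (hv : ∀ φ, 0 ≤ v φ) : v ∈ contrCone act :=
  ⟨Empty, Empty, inferInstance, inferInstance, 0, Empty.elim, fun x => by simp,
    fun φ => by simpa [dualNormSq] using hv φ⟩

theorem sub_mem_contrCone (act : X →ₗ[ℂ] E →ₗ[ℂ] E) {ι μ : Type} [Fintype ι] [Fintype μ]
    {T : Matrix ι μ X} (hT : IsContr T) (f : μ → E) :
    dualNormSq f - dualNormSq (fun i => ∑ j, act (T i j) (f j)) ∈ contrCone act :=
  ⟨ι, μ, inferInstance, inferInstance, T, f, hT, fun φ => by simp⟩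

/-- The subspace of vectors dominated by `u` with respect to a cone containing `u`. -/
def PointedCone.dominated {W : Type*} [AddCommGroup W] [Module ℝ W]
    (C : PointedCone ℝ W) (u : W) : Submodule ℝ W where
  carrier := {w | (∃ c : ℝ, c • u + w ∈ C) ∧ ∃ c : ℝ, c • u - w ∈ C}
  add_mem' := by
    rintro v w ⟨⟨a, ha⟩, b, hb⟩ ⟨⟨c, hc⟩, d, hd⟩
    refine ⟨⟨a + c, ?_⟩, b + d, ?_⟩
    · convert C.add_mem ha hc using 1
      module
    · convert C.add_mem hb hd using 1
      module
  zero_mem' := ⟨⟨0, by simp⟩, 0, by simp⟩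
  smul_mem' := by
    rintro r w ⟨⟨a, ha⟩, b, hb⟩
    rcases le_total 0 r with hr | hr
    · refine ⟨⟨r * a, ?_⟩, r * b, ?_⟩
      · convert C.smul_mem hr ha using 1
        module
      · convert C.smul_mem hr hb using 1
        module
    · have hr' : 0 ≤ -r := by linarith
      refine ⟨⟨-r * b, ?_⟩, -r * a, ?_⟩
      · convert C.smul_mem hr' hb using 1
        module
      · convert C.smul_mem hr' ha using 1
        module

/-- A cone which does not contain `u - v`, `u` being an order unit on the dominated subspace,
has a functional on the whole space which is positive on the dominated part of the cone, with
value one at `u` and at least one at `v`. -/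
theorem PointedCone.exists_separating_functional {W : Type*} [AddCommGroup W] [Module ℝ W]
    (C : PointedCone ℝ W) {u v : W} (hu : u ∈ C) (hv : v ∈ C.dominated u) (huv : u - v ∉ C) :
    ∃ s : W →ₗ[ℝ] ℝ, (∀ w ∈ C, w ∈ C.dominated u → 0 ≤ s w) ∧ s u = 1 ∧ 1 ≤ s v := by
  let D := C.dominated u
  have huD : u ∈ D := ⟨⟨0, by simpa using hu⟩, 1, by simp⟩
  let C' : PointedCone ℝ D :=
    { carrier := {w | ∃ r : ℝ, 0 ≤ r ∧ (w : W) - r • (v - u) ∈ C}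
      add_mem' := by
        rintro w w' ⟨r, hr, h⟩ ⟨r', hr', h'⟩
        refine ⟨r + r', add_nonneg hr hr', ?_⟩
        convert C.add_mem h h' using 1
        push_cast
        module
      zero_mem' := ⟨0, le_rfl, by simp⟩
      smul_mem' := by
        rintro ⟨c, hc⟩ w ⟨r, hr, h⟩
        refine ⟨c * r, mul_nonneg hc hr, ?_⟩
        convert C.smul_mem hc h using 1
        change c • (w : W) - _ = _
        module }
  have hC' : ∀ w : D, (w : W) ∈ C → w ∈ C' := fun w hw => ⟨0, le_rfl, by simpa using hw⟩
  have h1 : ∀ w : D, ∃ c : ℝ, c • (⟨u, huD⟩ : D) + w ∈ C' := by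
    rintro ⟨w, hw⟩
    obtain ⟨⟨c, hc⟩, -⟩ := id hw
    exact ⟨c, hC' _ hc⟩
  have h2 : -(⟨u, huD⟩ : D) ∉ C' := by
    rintro ⟨r, hr, h⟩
    have hneg : -u ∉ C := by
      intro hn
      obtain ⟨-, c, hc⟩ := id hv
      rcases le_total c 1 with h1 | h1
      · apply huv
        convert C.add_mem hc (C.smul_mem (sub_nonneg.2 h1) hu) using 1
        module
      · apply huv
        convert C.add_mem hc (C.smul_mem (sub_nonneg.2 h1) hn) using 1
        module
    have h2 : r • (u - v) ∈ C := by
      convert C.add_mem h hu using 1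
      push_cast
      module
    rcases hr.eq_or_lt with rfl | hr
    · exact hneg (by simpa using h)
    · apply huv
      have := C.smul_mem (inv_pos.2 hr).le h2
      rwa [smul_smul, inv_mul_cancel₀ hr.ne', one_smul] at this
  obtain ⟨s, hs, hs1⟩ := C'.exists_positive_functional ⟨u, huD⟩ h1 h2
  obtain ⟨S, hS⟩ := LinearMap.exists_extend s
  have hS' : ∀ w : D, S w = s w := fun w => by rw [← hS]; rfl
  refine ⟨S, fun w hw hwD => ?_, ?_, ?_⟩
  · rw [hS' ⟨w, hwD⟩]
    exact hs _ (hC' _ hw)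
  · rw [hS' ⟨u, huD⟩, hs1]
  · have := hs (⟨v, hv⟩ - ⟨u, huD⟩) ⟨1, zero_le_one, by simp⟩
    rw [map_sub, hs1] at this
    rw [hS' ⟨v, hv⟩]
    linarith

end PositiveFunctional

section Representation

omit [CompleteSpace H]

variable {X : Submodule ℂ (H →L[ℂ] H)} {E : Type} [AddCommGroup E] [Module ℂ E]

theorem dualNormSq_mem_dominated (act : X →ₗ[ℂ] E →ₗ[ℂ] E) {κ : Type} [Fintype κ] (I : κ → E)
    (hunit : ∀ u : E, ∃ c : ℝ, c • dualNormSq I - dualNormSq (fun _ : Unit => u) ∈ contrCone act)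
    {ι : Type} [Fintype ι] (f : ι → E) :
    dualNormSq f ∈ (contrCone act).dominated (dualNormSq I) := by
  have h1 : dualNormSq f = ∑ i, dualNormSq (fun _ : Unit => f i) := by
    funext φ
    simp [dualNormSq]
  rw [h1]
  refine Submodule.sum_mem _ fun i _ => ⟨⟨0, ?_⟩, hunit (f i)⟩
  refine mem_contrCone_of_nonneg act fun φ => ?_
  simp [dualNormSq]

/-- The sesquilinear form on `E` induced by a functional on functions on the dual space. -/
def functionalInner (S : (Module.Dual ℂ E → ℝ) →ₗ[ℝ] ℝ) (u v : E) : ℂ :=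
  ⟨S fun φ => (starRingEnd ℂ (φ u) * φ v).re, S fun φ => (starRingEnd ℂ (φ u) * φ v).im⟩

theorem functionalInner_self_re (S : (Module.Dual ℂ E → ℝ) →ₗ[ℝ] ℝ) (u : E) :
    (functionalInner S u u).re = S (dualNormSq fun _ : Unit => u) := by
  change S _ = S _
  congr 1
  funext φ
  simp [dualNormSq, ← Complex.normSq_eq_norm_sq, Complex.normSq_apply]

theorem sum_functionalInner_self_re (S : (Module.Dual ℂ E → ℝ) →ₗ[ℝ] ℝ) {ι : Type} [Fintype ι]
    (f : ι → E) : ∑ i, (functionalInner S (f i) (f i)).re = S (dualNormSq f) := by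
  have h1 : dualNormSq f = ∑ i, dualNormSq (fun _ : Unit => f i) := by
    funext φ
    simp [dualNormSq]
  simp only [functionalInner_self_re, h1, map_sum]

/-- The form induced by a positive functional is a pre-inner product. -/
@[reducible] def functionalCore (S : (Module.Dual ℂ E → ℝ) →ₗ[ℝ] ℝ)
    (hS : ∀ u : E, 0 ≤ S (dualNormSq fun _ : Unit => u)) : PreInnerProductSpace.Core ℂ E where
  inner := functionalInner S
  conj_inner_symm u v := by
    apply Complex.ext
    · simp only [functionalInner, Complex.conj_re]
      congr 1
      funext φ
      simp
      ring
    · simp only [functionalInner, Complex.conj_im, ← map_neg]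
      congr 1
      funext φ
      simp
      ring
  re_inner_nonneg u := by
    change 0 ≤ (functionalInner S u u).re
    rw [functionalInner_self_re]
    exact hS u
  add_left u v w := by
    apply Complex.ext
    · simp only [functionalInner, Complex.add_re, ← map_add]
      congr 1
      funext φ
      simp
      ring
    · simp only [functionalInner, Complex.add_im, ← map_add]
      congr 1
      funext φ
      simp
      ring
  smul_left u v r := by
    apply Complex.ext
    · simp only [functionalInner, Complex.mul_re, Complex.conj_re, Complex.conj_im,
        ← smul_eq_mul (r.re), ← smul_eq_mul (-r.im), ← map_smul, ← map_sub]
      congr 1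
      funext φ
      simp
      ring
    · simp only [functionalInner, Complex.mul_im, Complex.conj_re, Complex.conj_im,
        ← smul_eq_mul (r.re), ← smul_eq_mul (-r.im), ← map_smul, ← map_add]
      congr 1
      funext φ
      simp
      ring

/-- A pre-inner product for which contractive matrices over `X` act contractively and which
separates `A` from the image of the unit ball. -/
theorem exists_preInner (act : X →ₗ[ℂ] E →ₗ[ℂ] E) {κ : Type} [Fintype κ] (I : κ → E)
    (hunit : ∀ u : E, ∃ c : ℝ, c • dualNormSq I - dualNormSq (fun _ : Unit => u) ∈ contrCone act)
    {ι : Type} [Fintype ι] (A : ι → E) (hA : dualNormSq I - dualNormSq A ∉ contrCone act) :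
    ∃ c : PreInnerProductSpace.Core ℂ E,
      (∀ {p q : Type} [Fintype p] [Fintype q] (T : Matrix p q X) (f : q → E), IsContr T →
        ∑ i, (c.inner (∑ j, act (T i j) (f j)) (∑ j, act (T i j) (f j))).re ≤
          ∑ j, (c.inner (f j) (f j)).re) ∧
      ∑ j, (c.inner (I j) (I j)).re = 1 ∧ 1 ≤ ∑ i, (c.inner (A i) (A i)).re := by
  have hdom : ∀ {ι : Type} [Fintype ι] (f : ι → E),
      dualNormSq f ∈ (contrCone act).dominated (dualNormSq I) :=
    fun f => dualNormSq_mem_dominated act I hunit f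
  have hpos : ∀ {ι : Type} [Fintype ι] (f : ι → E), dualNormSq f ∈ contrCone act :=
    fun f => mem_contrCone_of_nonneg act fun φ => Finset.sum_nonneg fun i _ => sq_nonneg _
  obtain ⟨S, hS, hS1, hSA⟩ := (contrCone act).exists_separating_functional
    (hpos I) (hdom A) hA
  refine ⟨functionalCore S fun u => hS _ (hpos _) (hdom _), ?_, ?_, ?_⟩
  · intro p q _ _ T f hT
    have := hS _ (sub_mem_contrCone act hT f) (Submodule.sub_mem _ (hdom _) (hdom _))
    rw [map_sub, sub_nonneg] at this
    change ∑ i, (functionalInner S _ _).re ≤ ∑ j, (functionalInner S _ _).re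
    rwa [sum_functionalInner_self_re S fun i => ∑ j, act (T i j) (f j),
      sum_functionalInner_self_re]
  · exact (sum_functionalInner_self_re S I).trans hS1
  · exact hSA.trans_eq (sum_functionalInner_self_re S A).symm

open UniformSpace in
/-- A contractive action on a pre-Hilbert space extends to its completion. -/
theorem exists_representation_of_contractive {E : Type} [SeminormedAddCommGroup E]
    [InnerProductSpace ℂ E] (act : X →ₗ[ℂ] E →ₗ[ℂ] E)
    (hact : ∀ {p q : Type} [Fintype p] [Fintype q] (T : Matrix p q X) (f : q → E), IsContr T →
      ∑ i, ‖∑ j, act (T i j) (f j)‖ ^ 2 ≤ ∑ j, ‖f j‖ ^ 2) :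
    ∃ (K : Type) (_ : NormedAddCommGroup K) (_ : InnerProductSpace ℂ K) (_ : CompleteSpace K)
      (π : X →ₗ[ℂ] (K →L[ℂ] K)),
      (∀ x, (∀ u, act x u = u) → π x = 1) ∧
      (∀ x y z, (∀ u, act z u = act x (act y u)) → π z = π x * π y) ∧
      (∀ {p q : Type} [Fintype p] [Fintype q] (T : Matrix p q X), IsContr T →
        opMatNorm (T.map π) ≤ 1) ∧
      (∀ {p q : Type} [Fintype p] [Fintype q] (T : Matrix p q X) (f : q → E),
        ∑ i, ‖∑ j, act (T i j) (f j)‖ ^ 2 ≤ opMatNorm (T.map π) ^ 2 * ∑ j, ‖f j‖ ^ 2) := by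
  have hbound : ∀ x u, ‖act x u‖ ≤ (1 + ‖(x : H →L[ℂ] H)‖) * ‖u‖ := by
    intro x u
    have hx := norm_nonneg (x : H →L[ℂ] H)
    have h := hact _ (fun _ => u) (isContr_normalize x)
    simp only [Finset.univ_unique, Finset.sum_singleton, Matrix.of_apply, map_smul,
      LinearMap.smul_apply] at h
    have h2 := (pow_le_pow_iff_left₀ (norm_nonneg _) (norm_nonneg _) two_ne_zero).1 h
    rw [norm_smul, Complex.norm_real, Real.norm_of_nonneg (by positivity),
      div_mul_eq_mul_div, one_mul, div_le_iff₀ (by positivity)] at h2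
    linarith
  let ρ : X → (Completion E →L[ℂ] Completion E) := fun x =>
    (Completion.toComplL ∘L (act x).mkContinuous _ (hbound x)).extend Completion.toComplL
  have hρ : ∀ x (u : E), ρ x (u : Completion E) = (act x u : E) := fun x u =>
    ContinuousLinearMap.extend_eq _ Completion.denseRange_coe
      (Completion.isUniformInducing_coe E) u
  have hext : ∀ S T : Completion E →L[ℂ] Completion E, (∀ u : E, S u = T u) → S = T := by
    intro S T h
    ext u
    refine Completion.induction_on u (isClosed_eq (by fun_prop) (by fun_prop)) h
  let π : X →ₗ[ℂ] (Completion E →L[ℂ] Completion E) :=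
    { toFun := ρ
      map_add' x y := hext _ _ fun u => by simp [hρ, Completion.coe_add]
      map_smul' c x := hext _ _ fun u => by simp [hρ, Completion.coe_smul] }
  have hπ : ∀ x (u : E), π x (u : Completion E) = (act x u : E) := hρ
  have hsum : ∀ {p q : Type} [Fintype p] [Fintype q] (T : Matrix p q X) (f : q → E) (i : p),
      ∑ j, (T.map π) i j (f j : Completion E) = ((∑ j, act (T i j) (f j) : E) : Completion E) := by
    intro p q _ _ T f i
    rw [← Completion.coe_toComplL (𝕜 := ℂ), map_sum]
    exact Finset.sum_congr rfl fun j _ => hπ _ _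
  refine ⟨Completion E, inferInstance, inferInstance, inferInstance, π, fun x hx => ?_,
    fun x y z h => ?_, fun T hT => ?_, fun T f => ?_⟩
  · exact hext _ _ fun u => by simp [hπ, hx]
  · exact hext _ _ fun u => by simp [hπ, h]
  · rename_i q _ _
    rw [opMatNorm_le_iff _ zero_le_one]
    intro v
    have hd : DenseRange (Pi.map fun (_ : q) (u : E) => (u : Completion E)) :=
      DenseRange.piMap fun _ => Completion.denseRange_coe
    refine hd.induction_on v (isClosed_le (by fun_prop) (by fun_prop)) fun f => ?_
    simp only [Pi.map_apply, hsum, Completion.norm_coe, one_pow, one_mul]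
    exact hact T f hT
  · simpa only [hsum, Completion.norm_coe] using
      sum_norm_sq_le_opMatNorm (T.map π) fun j => (f j : Completion E)

end Representation

section Dichotomy

omit [CompleteSpace H]

variable {X : Submodule ℂ (H →L[ℂ] H)} {e : X}

/-- A contractive action on a space with a pre-inner product gives a contractive representation
on a Hilbert space. -/
theorem exists_representation_of_preCore {E : Type} [AddCommGroup E] [Module ℂ E]
    (c : PreInnerProductSpace.Core ℂ E) (act : X →ₗ[ℂ] E →ₗ[ℂ] E)
    (hact : ∀ {p q : Type} [Fintype p] [Fintype q] (T : Matrix p q X) (f : q → E), IsContr T →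
      ∑ i, (c.inner (∑ j, act (T i j) (f j)) (∑ j, act (T i j) (f j))).re ≤
        ∑ j, (c.inner (f j) (f j)).re) :
    ∃ (K : Type) (_ : NormedAddCommGroup K) (_ : InnerProductSpace ℂ K) (_ : CompleteSpace K)
      (π : X →ₗ[ℂ] (K →L[ℂ] K)),
      (∀ x, (∀ u, act x u = u) → π x = 1) ∧
      (∀ x y z, (∀ u, act z u = act x (act y u)) → π z = π x * π y) ∧
      (∀ {p q : Type} [Fintype p] [Fintype q] (T : Matrix p q X), IsContr T →
        opMatNorm (T.map π) ≤ 1) ∧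
      (∀ {p q : Type} [Fintype p] [Fintype q] (T : Matrix p q X) (f : q → E),
        ∑ i, (c.inner (∑ j, act (T i j) (f j)) (∑ j, act (T i j) (f j))).re ≤
          opMatNorm (T.map π) ^ 2 * ∑ j, (c.inner (f j) (f j)).re) := by
  let _ : SeminormedAddCommGroup E :=
    @InnerProductSpace.Core.toSeminormedAddCommGroup ℂ E _ _ _ c
  let _ : InnerProductSpace ℂ E := InnerProductSpace.ofCore c
  have hn : ∀ u : E, (c.inner u u).re = ‖u‖ ^ 2 := fun u =>
    (InnerProductSpace.norm_sq_eq_re_inner (𝕜 := ℂ) u).symm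
  simp only [hn] at hact ⊢
  exact exists_representation_of_contractive act hact

variable {M : Type} [AddCommGroup M] [Module ℂ M]
  {act : X →ₗ[ℂ] M →ₗ[ℂ] M} {κ : Type} [Fintype κ] {I : κ → M} {ι : Type} [Fintype ι]

/-- The action of `X` on the submodule of bounded vectors. -/
def boundedAct (he : ‖(e : H →L[ℂ] H)‖ = 1)
    (hact : ∀ x u, act e (act x u) = act x u) (hI : ∀ j, act e (I j) = I j) :
    X →ₗ[ℂ] boundedSubmodule he hact hI →ₗ[ℂ] boundedSubmodule he hact hI :=
  LinearMap.mk₂ ℂ (fun x u => ⟨act x u, act_mem_boundedSubmodule he hact hI x u.2⟩)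
    (fun x y u => Subtype.ext (by simp)) (fun c x u => Subtype.ext (by simp))
    (fun x u v => Subtype.ext (by simp)) (fun c x u => Subtype.ext (by simp))

theorem Reachable.mem_boundedSubmodule (he : ‖(e : H →L[ℂ] H)‖ = 1)
    (hact : ∀ x u, act e (act x u) = act x u) (hI : ∀ j, act e (I j) = I j)
    {f : ι → M} (hf : Reachable act I f) (i : ι) : f i ∈ boundedSubmodule he hact hI :=
  hf.bounded he hact hI i

/-- The base family in the submodule of bounded vectors. -/
def boundedBase (he : ‖(e : H →L[ℂ] H)‖ = 1)
    (hact : ∀ x u, act e (act x u) = act x u) (hI : ∀ j, act e (I j) = I j) (j : κ) :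
    boundedSubmodule he hact hI :=
  ⟨I j, Reachable.base.mem_boundedSubmodule he hact hI j⟩

theorem Reachable.sub_mem_contrCone (he : ‖(e : H →L[ℂ] H)‖ = 1)
    (hact : ∀ x u, act e (act x u) = act x u) (hI : ∀ j, act e (I j) = I j)
    {f : ι → M} (hf : Reachable act I f) (g : ι → boundedSubmodule he hact hI)
    (hg : ∀ i, (g i : M) = f i) :
    dualNormSq (boundedBase he hact hI) - dualNormSq g ∈ contrCone (boundedAct he hact hI) := by
  induction hf with
  | base =>
    have : g = boundedBase he hact hI := funext fun j => Subtype.ext (hg j)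
    rw [this, sub_self]
    exact Submodule.zero_mem _
  | @app ι μ _ _ T f hT hf ih =>
    let f' : μ → boundedSubmodule he hact hI := fun j => ⟨f j, hf.mem_boundedSubmodule he hact hI j⟩
    have : g = fun i => ∑ j, boundedAct he hact hI (T i j) (f' j) := by
      funext i
      apply Subtype.ext
      rw [hg, AddSubmonoidClass.coe_finsetSum]
      rfl
    rw [this]
    convert Submodule.add_mem _ (ih f' fun _ => rfl)
      (_root_.sub_mem_contrCone (boundedAct he hact hI) hT f') using 1
    abel

/-- Either the image of the base family under `A` is approximately reachable, or there is a
contractive representation in which `A` has norm at least one. -/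
theorem reachable_or_exists_representation (he : ‖(e : H →L[ℂ] H)‖ = 1)
    (hact : ∀ x u, act e (act x u) = act x u) (hI : ∀ j, act e (I j) = I j)
    (A : Matrix ι κ X) :
    (∀ t : ℝ, 0 ≤ t → t < 1 →
      Reachable act I ((t : ℂ) • fun i => ∑ j, act (A i j) (I j))) ∨
    ∃ (K : Type) (_ : NormedAddCommGroup K) (_ : InnerProductSpace ℂ K) (_ : CompleteSpace K)
      (π : X →ₗ[ℂ] (K →L[ℂ] K)), π e = 1 ∧
      (∀ x y z, (∀ u, act z u = act x (act y u)) → π z = π x * π y) ∧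
      (∀ {p q : Type} [Fintype p] [Fintype q] (T : Matrix p q X), IsContr T →
        opMatNorm (T.map π) ≤ 1) ∧ 1 ≤ opMatNorm (A.map π) := by
  let actE := boundedAct he hact hI
  let J := boundedBase he hact hI
  have hunit : ∀ u, ∃ c : ℝ, c • dualNormSq J - dualNormSq (fun _ : Unit => u) ∈
      contrCone actE := by
    intro u
    obtain ⟨c, hc, h⟩ := id u.2
    have h1 := h.sub_mem_contrCone he hact hI (fun _ => c • u) fun _ => rfl
    refine ⟨(‖c‖ ^ 2)⁻¹, ?_⟩
    convert PointedCone.smul_mem _ (r := (‖c‖ ^ 2)⁻¹) (by positivity) h1 using 1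
    rw [smul_sub]
    congr 1
    funext φ
    have : ‖c‖ ≠ 0 := norm_ne_zero_iff.2 hc
    simp only [dualNormSq, Finset.univ_unique, Finset.sum_singleton, map_smul, norm_mul,
      Pi.smul_apply, smul_eq_mul, mul_pow]
    field_simp
  by_cases hA : dualNormSq J - dualNormSq (fun i => ∑ j, actE (A i j) (J j)) ∈ contrCone actE
  · left
    intro t ht0 ht
    obtain ⟨p, q, _, _, T, f, hT, h⟩ := hA
    obtain ⟨G, hG, hGe⟩ := exists_isScalarContr_of_dual_le
      (Sum.elim J fun i => ∑ j, actE (T i j) (f j))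
      (Sum.elim (fun i => ∑ j, actE (A i j) (J j)) f) (fun φ => by
        have := h φ
        simp only [dualNormSq, Pi.sub_apply, Fintype.sum_sum_type, Sum.elim_inl,
          Sum.elim_inr] at this ⊢
        linarith)
    refine Reachable.transfer he hact hI hT hG
      (boundedFamily_of_forall he hact hI fun i => (f i).2) (fun i => ?_) ht0 ht
    have key := congrArg (Subtype.val) (hGe i)
    convert key using 1
    · rcases i with i | i
      · simp only [Sum.elim_inl, AddSubmonoidClass.coe_finsetSum]
        rfl
      · rfl
    · rw [AddSubmonoidClass.coe_finsetSum]
      refine Finset.sum_congr rfl fun j _ => ?_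
      rw [Submodule.coe_smul]
      congr 1
      rcases j with j | j
      · rfl
      · simp only [Sum.elim_inr, AddSubmonoidClass.coe_finsetSum]
        rfl
  · right
    obtain ⟨c, hc, hJ, hAJ⟩ := exists_preInner actE J hunit _ hA
    obtain ⟨K, i1, i2, i3, π, h1, h2, h3, h4⟩ := exists_representation_of_preCore c actE hc
    refine ⟨K, i1, i2, i3, π, h1 e fun u => ?_, fun x y z h => h2 x y z fun u => ?_, h3, ?_⟩
    · obtain ⟨c, hc, h⟩ := id u.2
      have := h.unit_act hact hI ()
      simp only [Pi.smul_apply, map_smul] at this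
      exact Subtype.ext (smul_right_injective M hc this)
    · exact Subtype.ext (h u)
    · have := hAJ.trans (h4 A J)
      rw [hJ, mul_one] at this
      nlinarith [opMatNorm_nonneg (A.map π)]

end Dichotomy

section DirectSum

omit [CompleteSpace H]

variable {X : Submodule ℂ (H →L[ℂ] H)}

theorem norm_le_of_contractive {K : Type} [NormedAddCommGroup K] [InnerProductSpace ℂ K]
    (π : X →ₗ[ℂ] (K →L[ℂ] K))
    (hπ : ∀ {p q : Type} [Fintype p] [Fintype q] (T : Matrix p q X), IsContr T →
      opMatNorm (T.map π) ≤ 1) (x : X) :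
    ‖π x‖ ≤ 1 + ‖(x : H →L[ℂ] H)‖ := by
  have hr : (0 : ℝ) < 1 + ‖(x : H →L[ℂ] H)‖ := by positivity
  refine ContinuousLinearMap.opNorm_le_bound _ hr.le fun v => ?_
  have h := (opMatNorm_le_iff _ zero_le_one).1 (hπ _ (isContr_normalize x)) (fun _ => v)
  simp only [Finset.univ_unique, Finset.sum_singleton, Matrix.map_apply, Matrix.of_apply,
    map_smul, one_pow, one_mul, smul_apply, norm_smul] at h
  rw [sq_le_sq₀ (by positivity) (norm_nonneg _), Complex.norm_real, Real.norm_of_nonneg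
    (by positivity), one_div, inv_mul_le_iff₀ hr] at h
  exact h

theorem exists_directSum {α : Type} (K : α → Type) [∀ a, NormedAddCommGroup (K a)]
    [∀ a, InnerProductSpace ℂ (K a)] [∀ a, CompleteSpace (K a)]
    (π : ∀ a, X →ₗ[ℂ] (K a →L[ℂ] K a))
    (hπ : ∀ a {p q : Type} [Fintype p] [Fintype q] (T : Matrix p q X), IsContr T →
      opMatNorm (T.map (π a)) ≤ 1) :
    ∃ (L : Type) (_ : NormedAddCommGroup L) (_ : InnerProductSpace ℂ L) (_ : CompleteSpace L)
      (ρ : X →ₗ[ℂ] (L →L[ℂ] L)),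
      (∀ x, (∀ a, π a x = 1) → ρ x = 1) ∧
      (∀ x y z, (∀ a, π a z = π a x * π a y) → ρ z = ρ x * ρ y) ∧
      (∀ {p q : Type} [Fintype p] [Fintype q] (T : Matrix p q X), IsContr T →
        opMatNorm (T.map ρ) ≤ 1) ∧
      (∀ a {p q : Type} [Fintype p] [Fintype q] (T : Matrix p q X),
        opMatNorm (T.map (π a)) ≤ opMatNorm (T.map ρ)) := by
  classical
  have hb : ∀ x a, ‖π a x‖ ≤ 1 + ‖(x : H →L[ℂ] H)‖ := fun x a =>
    norm_le_of_contractive (π a) (hπ a) x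
  let ρ : X →ₗ[ℂ] (lp K 2 →L[ℂ] lp K 2) :=
    { toFun := fun x => lp.mapCLM 2 (fun a => π a x) (by positivity) (hb x)
      map_add' := fun x y => by ext; simp
      map_smul' := fun c x => by ext; simp }
  have hρ : ∀ x (u : lp K 2) a, ρ x u a = π a x (u a) := fun x u a => by simp [ρ]
  have hsum : ∀ u : lp K 2, HasSum (fun a => ‖u a‖ ^ 2) (‖u‖ ^ 2) := fun u => by
    simpa using lp.hasSum_norm (p := 2) (by norm_num) u
  refine ⟨lp K 2, inferInstance, inferInstance, inferInstance, ρ, ?_, ?_, ?_, ?_⟩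
  · intro x hx
    ext u a
    simp [hρ, hx]
  · intro x y z h
    ext u a
    simp [hρ, h]
  · intro p q _ _ T hT
    refine (opMatNorm_le_iff _ zero_le_one).2 fun v => ?_
    rw [one_pow, one_mul]
    refine hasSum_le (fun a => ?_) (hasSum_sum fun i _ => hsum _) (hasSum_sum fun j _ => hsum _)
    have h := (opMatNorm_le_iff _ zero_le_one).1 (hπ a T hT) (fun j => v j a)
    have h2 : ∀ i, (∑ j, (T.map ρ) i j (v j)) a = ∑ j, (T.map (π a)) i j (v j a) := by
      intro i
      rw [lp.coeFn_sum, Finset.sum_apply]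
      simp only [Matrix.map_apply, hρ]
    simpa only [h2, one_pow, one_mul] using h
  · intro a p q _ _ T
    refine (opMatNorm_le_iff _ (opMatNorm_nonneg _)).2 fun v => ?_
    have h := sum_norm_sq_le_opMatNorm (T.map ρ) (fun j => lp.single 2 a (v j))
    have h2 : ∀ i, ∑ j, (T.map ρ) i j (lp.single 2 a (v j)) =
        lp.single 2 a (∑ j, (T.map (π a)) i j (v j)) := by
      intro i
      ext b
      rw [lp.coeFn_sum, Finset.sum_apply]
      by_cases hba : b = a
      · subst hba
        simp [hρ]
      · simp [hρ, hba]
    simpa only [h2, lp.norm_single (by norm_num : (0 : ENNReal) < 2)] using h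

end DirectSum

section Chains

omit [CompleteSpace H]

/-- The iterated product of a sequence of composable matrices, as a sum over paths. -/
def pathSum {R : Type*} [Semiring R] {N : ℕ} (dims : Fin (N + 1) → ℕ)
    (M : ∀ i : Fin N, Matrix (Fin (dims i.castSucc)) (Fin (dims i.succ)) R) :
    Matrix (Fin (dims 0)) (Fin (dims (Fin.last N))) R :=
  Matrix.of fun i j => ∑ p : (∀ t, Fin (dims t)) with p 0 = i ∧ p (Fin.last N) = j,
    (List.ofFn fun t : Fin N => M t (p t.castSucc) (p t.succ)).prod

theorem pathSum_zero {R : Type*} [Semiring R] (dims : Fin 1 → ℕ)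
    (M : ∀ i : Fin 0, Matrix (Fin (dims i.castSucc)) (Fin (dims i.succ)) R) :
    pathSum dims M = (1 : Matrix (Fin (dims 0)) (Fin (dims 0)) R) := by
  ext i j
  simp only [pathSum, Matrix.of_apply, List.ofFn_zero, List.prod_nil, Matrix.one_apply]
  split_ifs with h
  · subst h
    rw [Finset.sum_eq_single (fun t => Fin.cast (by rw [Subsingleton.elim (α := Fin 1) t 0]) i)]
    · intro p hp hne
      refine absurd ?_ hne
      funext t
      obtain rfl := Subsingleton.elim (α := Fin 1) 0 t
      simpa using (Finset.mem_filter.1 hp).2.1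
    · intro hp
      simp at hp
  · refine Finset.sum_eq_zero fun p hp => absurd ?_ h
    obtain ⟨h1, h2⟩ := (Finset.mem_filter.1 hp).2
    exact h1.symm.trans h2

theorem Finset.sum_mul_sum_filter_eq_and {R ι κ : Type*} [Semiring R] [Fintype ι] [Fintype κ]
    [DecidableEq κ] (g : κ → R) (a : ι → κ) (F : ι → R) (P : ι → Prop) [DecidablePred P] :
    ∑ r, g r * ∑ q with a q = r ∧ P q, F q = ∑ q with P q, g (a q) * F q := by
  simp only [Finset.mul_sum, Finset.sum_filter, ite_and, mul_ite, mul_zero]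
  rw [Finset.sum_comm]
  simp

theorem pathSum_succ {R : Type*} [Semiring R] {N : ℕ} (dims : Fin (N + 2) → ℕ)
    (M : ∀ i : Fin (N + 1), Matrix (Fin (dims i.castSucc)) (Fin (dims i.succ)) R) :
    pathSum dims M = (M 0 : Matrix (Fin (dims 0)) (Fin (dims (Fin.succ 0))) R) *
      (pathSum (fun i => dims i.succ) (fun i => M i.succ) :
        Matrix (Fin (dims (Fin.succ 0))) (Fin (dims (Fin.last (N + 1)))) R) := by
  funext i j
  refine Eq.trans ?_ (Finset.sum_mul_sum_filter_eq_and (fun r : Fin (dims (Fin.succ 0)) => M 0 i r)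
    (fun q : (∀ t : Fin (N + 1), Fin (dims t.succ)) => q 0)
    (fun q => (List.ofFn fun t : Fin N => M t.succ (q t.castSucc) (q t.succ)).prod)
    (fun q => q (Fin.last N) = j)).symm
  refine Finset.sum_bij' (fun p _ t => p t.succ) (fun q _ => Fin.cons i q) ?_ ?_ ?_ ?_ ?_
  · intro p hp
    exact Finset.mem_filter.2 ⟨Finset.mem_univ _, (Finset.mem_filter.1 hp).2.2⟩
  · intro q hq
    exact Finset.mem_filter.2 ⟨Finset.mem_univ _, rfl, (Finset.mem_filter.1 hq).2⟩
  · intro p hp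
    obtain ⟨rfl, -⟩ := (Finset.mem_filter.1 hp).2
    exact Fin.cons_self_tail p
  · intro q hq
    rfl
  · intro p hp
    obtain ⟨rfl, -⟩ := (Finset.mem_filter.1 hp).2
    rw [List.ofFn_succ, List.prod_cons]
    rfl

theorem pathSum_map {R S : Type*} [Semiring R] [Semiring S] (φ : R →+* S) {N : ℕ}
    (dims : Fin (N + 1) → ℕ)
    (M : ∀ i : Fin N, Matrix (Fin (dims i.castSucc)) (Fin (dims i.succ)) R) :
    (pathSum dims M).map φ = pathSum dims (fun i => (M i).map φ) := by
  ext i j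
  simp [pathSum, map_list_prod, List.map_ofFn, Function.comp_def]

theorem opMatNorm_one_le {K : Type} [NormedAddCommGroup K] [InnerProductSpace ℂ K] {n : ℕ} :
    opMatNorm (1 : Matrix (Fin n) (Fin n) (K →L[ℂ] K)) ≤ 1 := by
  refine (opMatNorm_le_iff _ zero_le_one).2 fun v => ?_
  rw [one_pow, one_mul]
  refine Finset.sum_le_sum fun i _ => ?_
  rw [Finset.sum_eq_single i (by intro b _ hb; simp [Matrix.one_apply_ne hb.symm]) (by simp)]
  simp

theorem opMatNorm_pathSum_le {K : Type} [NormedAddCommGroup K] [InnerProductSpace ℂ K] {N : ℕ}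
    (dims : Fin (N + 1) → ℕ)
    (M : ∀ i : Fin N, Matrix (Fin (dims i.castSucc)) (Fin (dims i.succ)) (K →L[ℂ] K)) :
    opMatNorm (pathSum dims M) ≤ ∏ i, opMatNorm (M i) := by
  induction N with
  | zero =>
    rw [pathSum_zero]
    simpa using opMatNorm_one_le
  | succ N ih =>
    rw [pathSum_succ, Fin.prod_univ_succ]
    exact (opMatNorm_mul_le _ _).trans (mul_le_mul_of_nonneg_left (ih _ _) (opMatNorm_nonneg _))

theorem MatChain.prodIn_mk {V R : Type*} [Semiring R] {N : ℕ} (dims : Fin (N + 1) → ℕ)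
    (M : ∀ i : Fin N, Matrix (Fin (dims i.castSucc)) (Fin (dims i.succ)) V) (f : V → R) :
    MatChain.prodIn ⟨N, dims, rfl, rfl, M⟩ f = pathSum dims (fun i => (M i).map f) := rfl

variable {X : Submodule ℂ (H →L[ℂ] H)} {e : X}

theorem MatChain.exists_nil (k : ℕ) {R : Type*} [Semiring R] (f : X → R) :
    ∃ C : MatChain X k k, C.prodIn f = 1 ∧ chainCost C = 1 := by
  refine ⟨⟨0, fun _ => k, rfl, rfl, Fin.elim0⟩, ?_, ?_⟩
  · rw [MatChain.prodIn_mk]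
    exact pathSum_zero _ _
  · simp [chainCost]

theorem MatChain.exists_cons {n l k : ℕ} (T : Matrix (Fin n) (Fin l) X) (C : MatChain X l k)
    {R : Type*} [Semiring R] (f : X → R) :
    ∃ C' : MatChain X n k, 1 ≤ C'.len ∧ C'.prodIn f = T.map f * C.prodIn f ∧
      chainCost C' = subMatNorm T * chainCost C := by
  obtain ⟨N, dims, rfl, rfl, M⟩ := C
  let d : Fin (N + 2) → ℕ := Fin.cons n dims
  let M' : ∀ i : Fin (N + 1), Matrix (Fin (d i.castSucc)) (Fin (d i.succ)) X := Fin.cons T M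
  refine ⟨⟨N + 1, d, rfl, rfl, M'⟩, by simp, pathSum_succ d fun i => (M' i).map f, ?_⟩
  rw [chainCost, Fin.prod_univ_succ]
  rfl

end Chains

section FactorizationNorm

omit [CompleteSpace H]

variable {X : Submodule ℂ (H →L[ℂ] H)} {e : X} (P : PartialProduct X e)

/-- The canonical map into `F_m(X)`, as a linear map. -/
def PartialProduct.embLinear : X →ₗ[ℂ] P.FreeAlg :=
  (RingQuot.mkAlgHom ℂ P.rel).toLinearMap ∘ₗ TensorAlgebra.ι ℂ

theorem PartialProduct.embLinear_apply (x : X) : P.embLinear x = P.emb x := rfl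

theorem PartialProduct.emb_mul {a b : X} (h : (a, b) ∈ P.D) :
    P.emb a * P.emb b = P.emb (P.m a b) := by
  have := RingQuot.mkAlgHom_rel ℂ (s := P.rel) ⟨a, b, h, rfl, rfl⟩
  rwa [map_mul] at this

theorem PartialProduct.emb_unit_mul (x : X) : P.emb e * P.emb x = P.emb x := by
  rw [P.emb_mul (by simpa using P.unit_left 1 x), P.m_unital_left]

theorem PartialProduct.emb_mul_unit (x : X) : P.emb x * P.emb e = P.emb x := by
  rw [P.emb_mul (by simpa using P.unit_right 1 x), P.m_unital_right]

/-- The action of `X` on columns over `F_m(X)` by left multiplication. -/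
def PartialProduct.columnAct (k : ℕ) : X →ₗ[ℂ] (Fin k → P.FreeAlg) →ₗ[ℂ] (Fin k → P.FreeAlg) :=
  LinearMap.mk₂ ℂ (fun x u i => P.embLinear x * u i)
    (fun x y u => by ext; simp [add_mul]) (fun c x u => by ext; simp)
    (fun x u v => by ext; simp [mul_add]) (fun c x u => by ext; simp)

theorem PartialProduct.columnAct_apply {k : ℕ} (x : X) (u : Fin k → P.FreeAlg) (i : Fin k) :
    P.columnAct k x u i = P.emb x * u i := rfl

theorem PartialProduct.columnAct_unit {k : ℕ} (x : X) (u : Fin k → P.FreeAlg) :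
    P.columnAct k e (P.columnAct k x u) = P.columnAct k x u := by
  funext i
  simp only [P.columnAct_apply, ← mul_assoc, P.emb_unit_mul]

/-- The columns of the diagonal matrix over `F_m(X)` with diagonal entries `e`. -/
def PartialProduct.unitColumn (k : ℕ) (j : Fin k) : Fin k → P.FreeAlg := Pi.single j (P.emb e)

theorem PartialProduct.columnAct_unitColumn {k : ℕ} (j : Fin k) :
    P.columnAct k e (P.unitColumn k j) = P.unitColumn k j := by
  funext i
  rw [P.columnAct_apply, unitColumn]
  rcases eq_or_ne i j with rfl | h
  · simp [P.emb_unit_mul]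
  · simp [h]

theorem PartialProduct.sum_columnAct_unitColumn {k : ℕ} (x : Fin k → X) :
    ∑ j, P.columnAct k (x j) (P.unitColumn k j) = fun j => P.emb (x j) := by
  funext i
  rw [Finset.sum_apply, Finset.sum_eq_single i]
  · simp [P.columnAct_apply, unitColumn, P.emb_mul_unit]
  · intro j _ h
    simp [P.columnAct_apply, unitColumn, h.symm]
  · simp

theorem chainCost_nonneg {n k : ℕ} (C : MatChain X n k) : 0 ≤ chainCost C :=
  Finset.prod_nonneg fun _ _ => opMatNorm_nonneg _

theorem Reachable.exists_chain (he : ‖(e : H →L[ℂ] H)‖ = 1) {k : ℕ} {ι : Type} [Fintype ι]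
    {f : ι → Fin k → P.FreeAlg} (hf : Reachable (P.columnAct k) (P.unitColumn k) f) :
    ∀ {n : ℕ} (s : ι ≃ Fin n), ∃ C : MatChain X n k,
      C.prodIn P.emb = Matrix.of (fun i => f (s.symm i)) ∧ chainCost C ≤ 1 := by
  classical
  induction hf with
  | base =>
    intro n s
    obtain ⟨C, hC, hc⟩ := MatChain.exists_nil (X := X) k P.emb
    let T : Matrix (Fin n) (Fin k) X :=
      Matrix.of fun i j => (if s.symm i = j then (1 : ℂ) else 0) • e
    have hT : IsContr T := (isScalarContr_reindex s.symm.injective).isContr he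
    obtain ⟨C', -, hC', hc'⟩ := MatChain.exists_cons T C P.emb
    refine ⟨C', ?_, ?_⟩
    · rw [hC', hC, Matrix.mul_one]
      ext i j
      simp only [T, Matrix.map_apply, Matrix.of_apply, PartialProduct.unitColumn, Pi.single_apply,
        ← P.embLinear_apply, ite_smul, one_smul, zero_smul, eq_comm (a := j)]
      split_ifs <;> simp
    · rw [hc', hc, mul_one]
      exact (isContr_iff T).1 hT
  | @app ι μ _ _ T f hT hf ih =>
    intro n s
    obtain ⟨C, hC, hc⟩ := ih (Fintype.equivFin μ)
    obtain ⟨C', -, hC', hc'⟩ := MatChain.exists_cons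
      (T.submatrix s.symm (Fintype.equivFin μ).symm) C P.emb
    refine ⟨C', ?_, ?_⟩
    · rw [hC', hC]
      ext i j
      simp only [Matrix.mul_apply, Matrix.map_apply, Matrix.submatrix_apply, Matrix.of_apply,
        Finset.sum_apply, P.columnAct_apply]
      exact (Fintype.equivFin μ).symm.sum_comp fun r => P.emb (T (s.symm i) r) * f r j
    · rw [hc']
      refine mul_le_one₀ ((isContr_iff _).1 ?_) (chainCost_nonneg C) hc
      intro v
      have h := hT (fun r => v (Fintype.equivFin μ r))
      rw [(Fintype.equivFin μ).sum_comp (fun r => ‖v r‖ ^ 2)] at h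
      refine le_trans (le_of_eq ?_) h
      rw [← s.symm.sum_comp]
      refine Finset.sum_congr rfl fun i _ => ?_
      rw [← (Fintype.equivFin μ).sum_comp]
      simp

theorem factNorm_bddBelow {n k : ℕ} (A : Matrix (Fin n) (Fin k) X) :
    BddBelow { r : ℝ | ∃ C : MatChain X n k, 1 ≤ C.len ∧
      C.prodIn P.emb = A.map P.emb ∧ r = chainCost C } :=
  ⟨0, by rintro r ⟨C, -, -, rfl⟩; exact chainCost_nonneg C⟩

theorem factNorm_set_nonempty {n k : ℕ} (A : Matrix (Fin n) (Fin k) X) :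
    { r : ℝ | ∃ C : MatChain X n k, 1 ≤ C.len ∧
      C.prodIn P.emb = A.map P.emb ∧ r = chainCost C }.Nonempty := by
  obtain ⟨C, hC, hc⟩ := MatChain.exists_nil (X := X) k P.emb
  obtain ⟨C', h1, hC', -⟩ := MatChain.exists_cons A C P.emb
  exact ⟨_, C', h1, by rw [hC', hC, Matrix.mul_one], rfl⟩

/-- A family of columns proportional to a reachable one bounds the factorization norm. -/
theorem factNorm_le_of_reachable (he : ‖(e : H →L[ℂ] H)‖ = 1) {n k : ℕ}
    (A : Matrix (Fin n) (Fin k) X) {t : ℝ} (ht : 0 < t)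
    (hA : Reachable (P.columnAct k) (P.unitColumn k)
      ((t : ℂ) • fun i => ∑ j, P.columnAct k (A i j) (P.unitColumn k j))) :
    factNorm P A ≤ t⁻¹ := by
  classical
  obtain ⟨C, hC, hc⟩ := hA.exists_chain P he (Equiv.refl _)
  let T : Matrix (Fin n) (Fin n) X :=
    Matrix.of fun i j => (if i = j then (1 : ℂ) else 0) • e
  have hT : IsContr T := (isScalarContr_reindex Function.injective_id).isContr he
  obtain ⟨C', h1, hC', hc'⟩ := MatChain.exists_cons (((t⁻¹ : ℝ) : ℂ) • T) C P.emb
  have hT' : subMatNorm (((t⁻¹ : ℝ) : ℂ) • T) ≤ t⁻¹ := by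
    have h := opMatNorm_smul_le ((t⁻¹ : ℝ) : ℂ) (T.map (fun v => (v : H →L[ℂ] H)))
    rw [Complex.norm_real, Real.norm_of_nonneg (by positivity)] at h
    refine h.trans (mul_le_of_le_one_right (by positivity) ((isContr_iff T).1 hT))
  have h0 : 0 ≤ subMatNorm (((t⁻¹ : ℝ) : ℂ) • T) := opMatNorm_nonneg _
  refine (csInf_le (factNorm_bddBelow P A) ⟨C', h1, ?_, rfl⟩).trans ?_
  · rw [hC', hC]
    ext i j
    have h2 : ∀ i, ∑ j, P.columnAct k (A i j) (P.unitColumn k j) = fun j => P.emb (A i j) :=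
      fun i => P.sum_columnAct_unitColumn (A i)
    have htc : (t : ℂ) ≠ 0 := by exact_mod_cast ht.ne'
    have h3 : ∀ r, (((t⁻¹ : ℝ) : ℂ) • T).map P.emb i r =
        if i = r then (t : ℂ)⁻¹ • P.emb e else 0 := by
      intro r
      change P.embLinear (((t⁻¹ : ℝ) : ℂ) • (if i = r then (1 : ℂ) else 0) • e) = _
      rw [map_smul, map_smul, P.embLinear_apply]
      split_ifs <;> simp
    simp only [Matrix.mul_apply, h3, h2, ite_mul, zero_mul, Finset.sum_ite_eq, Finset.mem_univ,
      if_true, Matrix.of_apply, Matrix.map_apply, Pi.smul_apply, Equiv.refl_symm,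
      Equiv.refl_apply, smul_mul_smul_comm, inv_mul_cancel₀ htc, one_smul, P.emb_unit_mul]
  · rw [hc']
    calc _ ≤ t⁻¹ * 1 := mul_le_mul hT' hc (chainCost_nonneg C) (by positivity)
      _ = t⁻¹ := mul_one _

theorem opMatNorm_map_le_subMatNorm {K : Type} [NormedAddCommGroup K] [InnerProductSpace ℂ K]
    (π : X →ₗ[ℂ] (K →L[ℂ] K))
    (hπ : ∀ {p q : Type} [Fintype p] [Fintype q] (T : Matrix p q X), IsContr T →
      opMatNorm (T.map π) ≤ 1)
    {p q : Type} [Fintype p] [Fintype q] (T : Matrix p q X) :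
    opMatNorm (T.map π) ≤ subMatNorm T := by
  have h0 : 0 ≤ subMatNorm T := opMatNorm_nonneg _
  refine le_of_forall_gt_imp_ge_of_dense fun r hr => ?_
  have hr0 : 0 < r := h0.trans_lt hr
  have h1 : IsContr (((r⁻¹ : ℝ) : ℂ) • T) := by
    rw [isContr_iff]
    have h := opMatNorm_smul_le ((r⁻¹ : ℝ) : ℂ) (T.map (fun v => (v : H →L[ℂ] H)))
    rw [Complex.norm_real, Real.norm_of_nonneg (by positivity)] at h
    refine h.trans ?_
    rw [inv_mul_le_iff₀ hr0, mul_one]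
    exact hr.le
  have h2 := opMatNorm_smul_le (r : ℂ) ((((r⁻¹ : ℝ) : ℂ) • T).map π)
  have h3 : (r : ℂ) • ((((r⁻¹ : ℝ) : ℂ) • T).map π) = T.map π := by
    have hrc : (r : ℂ) ≠ 0 := by exact_mod_cast hr0.ne'
    ext i j : 2
    simp [smul_smul, hrc]
  rw [h3, Complex.norm_real, Real.norm_of_nonneg hr0.le] at h2
  exact h2.trans (mul_le_of_le_one_right hr0.le (hπ _ h1))

theorem opMatNorm_map_le_factNorm {K : Type} [NormedAddCommGroup K] [InnerProductSpace ℂ K]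
    (π : X →ₗ[ℂ] (K →L[ℂ] K))
    (hmul : ∀ a b, (a, b) ∈ P.D → π (P.m a b) = π a * π b)
    (hπ : ∀ {p q : Type} [Fintype p] [Fintype q] (T : Matrix p q X), IsContr T →
      opMatNorm (T.map π) ≤ 1)
    {n k : ℕ} (A : Matrix (Fin n) (Fin k) X) :
    opMatNorm (A.map π) ≤ factNorm P A := by
  let Φ : P.FreeAlg →ₐ[ℂ] (K →L[ℂ] K) := RingQuot.liftAlgHom ℂ ⟨TensorAlgebra.lift ℂ π, by
    rintro _ _ ⟨a, b, h, rfl, rfl⟩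
    simp [hmul a b h]⟩
  have hΦ : ∀ x, Φ (P.emb x) = π x := fun x => by
    simp [Φ, PartialProduct.emb]
  refine le_csInf (factNorm_set_nonempty P A) ?_
  rintro _ ⟨⟨N, dims, rfl, rfl, M⟩, -, hC, rfl⟩
  have h1 : A.map π = pathSum dims (fun i => (M i).map π) := by
    have h2 := congrArg (fun B => B.map (Φ : P.FreeAlg →+* (K →L[ℂ] K))) hC
    simp only [MatChain.prodIn_mk, pathSum_map, Matrix.map_map] at h2
    have h3 : ((Φ : P.FreeAlg →+* (K →L[ℂ] K)) : P.FreeAlg → (K →L[ℂ] K)) ∘ P.emb = fun x => π x :=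
      funext hΦ
    rw [h3] at h2
    exact h2.symm
  rw [h1]
  refine (opMatNorm_pathSum_le _ _).trans ?_
  exact Finset.prod_le_prod (fun i _ => opMatNorm_nonneg _)
    fun i _ => opMatNorm_map_le_subMatNorm π hπ (M i)

end FactorizationNorm

/-- **Representation theorem for factorization norms.**  Let `X ⊆ B(H)` be a linear subspace,
`e ∈ X` with `‖e‖ = 1`, and `m` a non-degenerate partial product on `X`, and suppose that the
factorization seminorms `‖·‖^m` are norms (positive on nonzero matrices).  Then there are a
Hilbert space `K` and a linear map `π : X → B(K)` with `π(e) = I`,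
`π(m(a,b)) = π(a) π(b)` for all `(a,b) ∈ D`, and `‖π⁽ⁿ'ᵏ⁾(A)‖ = ‖A‖^m` for every matrix `A`
over `X`. -/
theorem factNorm_representation (X : Submodule ℂ (H →L[ℂ] H)) (e : ↥X)
    (he : ‖(e : H →L[ℂ] H)‖ = 1) (P : PartialProduct ↥X e)
    (hnd : Function.Injective P.emb)
    (hnorm : ∀ (n k : ℕ) (A : Matrix (Fin n) (Fin k) ↥X), A ≠ 0 → 0 < factNorm P A) :
    ∃ (K : Type) (_ : NormedAddCommGroup K) (_ : InnerProductSpace ℂ K) (_ : CompleteSpace K)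
      (π : ↥X →ₗ[ℂ] (K →L[ℂ] K)),
      π e = 1 ∧
      (∀ a b : ↥X, (a, b) ∈ P.D → π (P.m a b) = π a * π b) ∧
      (∀ (n k : ℕ) (A : Matrix (Fin n) (Fin k) ↥X), opMatNorm (A.map ⇑π) = factNorm P A) := by
  have hact : ∀ (k : ℕ) (x : X) u, P.columnAct k e (P.columnAct k x u) = P.columnAct k x u :=
    fun k x u => P.columnAct_unit x u
  have hI : ∀ (k : ℕ) j, P.columnAct k e (P.unitColumn k j) = P.unitColumn k j :=
    fun k j => P.columnAct_unitColumn j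
  let Approx : (Σ n k : ℕ, Matrix (Fin n) (Fin k) X) → Prop := fun A =>
    ∀ t : ℝ, 0 ≤ t → t < 1 → Reachable (P.columnAct A.2.1) (P.unitColumn A.2.1)
      ((t : ℂ) • fun i => ∑ j, P.columnAct A.2.1 (A.2.2 i j) (P.unitColumn A.2.1 j))
  have hrep := fun A : {A // ¬ Approx A} =>
    (reachable_or_exists_representation he (hact A.1.2.1) (hI A.1.2.1) A.1.2.2).resolve_left A.2
  choose K _ _ _ π hunit hmul hcontr hlow using hrep
  obtain ⟨L, _, _, _, ρ, hρ_one, hρ_mul, hρ_contr, hρ_low⟩ := exists_directSum K π hcontr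
  have hmul' : ∀ a b, (a, b) ∈ P.D → ρ (P.m a b) = ρ a * ρ b := fun a b hab =>
    hρ_mul _ _ _ fun A => hmul A _ _ _ fun u => by
      funext i
      simp only [P.columnAct_apply, ← mul_assoc, P.emb_mul hab]
  refine ⟨L, inferInstance, inferInstance, inferInstance, ρ, hρ_one e hunit, hmul', ?_⟩
  intro n k A
  refine le_antisymm (opMatNorm_map_le_factNorm P ρ hmul' hρ_contr A) ?_
  by_contra! hlt
  obtain ⟨t, htA, ht⟩ := exists_between hlt
  have ht0 : 0 < t := (opMatNorm_nonneg _).trans_lt htA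
  by_cases hB : Approx ⟨n, k, ((t⁻¹ : ℝ) : ℂ) • A⟩
  · obtain ⟨r, htr, hr⟩ := exists_between ht
    have hr0 : 0 < r := ht0.trans htr
    have h1 := hB (t / r) (by positivity) ((div_lt_one hr0).2 htr)
    have h2 := factNorm_le_of_reachable P he A (t := r⁻¹) (by positivity) (by
      convert h1 using 1
      funext i
      have htc : (t : ℂ) ≠ 0 := by exact_mod_cast ht0.ne'
      simp only [Pi.smul_apply, Matrix.smul_apply, map_smul, LinearMap.smul_apply,
        ← Finset.smul_sum, smul_smul]
      congr 1
      push_cast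
      field_simp)
    rw [inv_inv] at h2
    exact absurd h2 hr.not_ge
  · have h1 := (hlow ⟨_, hB⟩).trans (hρ_low ⟨_, hB⟩ _)
    have h2 : (((t⁻¹ : ℝ) : ℂ) • A).map ρ = ((t⁻¹ : ℝ) : ℂ) • A.map ρ := by
      ext i j : 2
      simp
    change 1 ≤ opMatNorm ((((t⁻¹ : ℝ) : ℂ) • A).map ρ) at h1
    have h3 := h1.trans (h2 ▸ opMatNorm_smul_le ((t⁻¹ : ℝ) : ℂ) (A.map ρ))
    rw [Complex.norm_real, Real.norm_of_nonneg (by positivity), le_inv_mul_iff₀ ht0, mul_one] at h3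
    exact absurd htA h3.not_gt
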